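/- arXiv:1909.06829 — 3 statements merged into one kernel-verified Lean document; each statement's English description precedes it below -/
import Mathlib

section
/- Every normalized unconditional basis of the Banach space ℓ₁ ⊕ ℓ₂ is permutatively equivalent to the canonical basis of ℓ₁ ⊕ ℓ₂, i.e., to the direct sum of the unit vector bases of ℓ₁ and ℓ₂. (This is the instance A = {1,2} of the paper's uniqueness theorem.) -/
open scoped ENNReal

noncomputable section

instance : Fact ((1 : ℝ≥0∞) ≤ 2) := ⟨one_le_two⟩

/-- The closed linear span of a family of vectors. -/
def closedSpan {X : Type*} [NormedAddCommGroup X] [NormedSpace ℝ X]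
    {J : Type*} (x : J → X) : Submodule ℝ X :=
  (Submodule.span ℝ (Set.range x)).topologicalClosure

theorem mem_closedSpan {X : Type*} [NormedAddCommGroup X] [NormedSpace ℝ X]
    {J : Type*} (x : J → X) (j : J) : x j ∈ closedSpan x :=
  Submodule.le_topologicalClosure _ (Submodule.subset_span ⟨j, rfl⟩)

/-- Two families of vectors are permutatively equivalent if some bijection of the index sets
is implemented by a linear homeomorphism between their closed linear spans. -/
def PermutativelyEquivalent {X Y : Type*} [NormedAddCommGroup X] [NormedSpace ℝ X]
    [NormedAddCommGroup Y] [NormedSpace ℝ Y]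
    {J I : Type*} (x : J → X) (y : I → Y) : Prop :=
  ∃ (π : J ≃ I) (T : closedSpan x ≃L[ℝ] closedSpan y),
    ∀ j : J, (T ⟨x j, mem_closedSpan x j⟩ : Y) = y (π j)

/-- The canonical basis of `ℓ₁ ⊕ ℓ₂`: unit vectors of `ℓ₁` in the first coordinate together
with unit vectors of `ℓ₂` in the second coordinate. -/
def canBasisL1L2 : ℕ ⊕ ℕ → (lp (fun _ : ℕ => ℝ) 1) × (lp (fun _ : ℕ => ℝ) 2) :=
  Sum.elim (fun n => (lp.single 1 n (1 : ℝ), 0)) (fun n => (0, lp.single 2 n (1 : ℝ)))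

open Finset Filter Topology

section signs

open Classical in
def sgnf {J : Type*} (B : Finset J) (j : J) : ℝ := if j ∈ B then 1 else -1

lemma abs_sgnf {J : Type*} (B : Finset J) (j : J) : |sgnf B j| = 1 := by
  unfold sgnf; split_ifs <;> simp

lemma sgnf_mul_self {J : Type*} (B : Finset J) (j : J) : sgnf B j * sgnf B j = 1 := by
  unfold sgnf; split_ifs <;> simp

open Classical in
lemma sgn_step {J V : Type*} [AddCommGroup V] [Module ℝ V] (F : V → ℝ) (w : J → V)
    (a : J) (A : Finset J) (ha : a ∉ A) :
    ∑ B ∈ (insert a A).powerset, F (∑ j ∈ insert a A, sgnf B j • w j) =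
      ∑ B ∈ A.powerset, (F ((∑ j ∈ A, sgnf B j • w j) - w a)
        + F ((∑ j ∈ A, sgnf B j • w j) + w a)) := by
  rw [Finset.sum_powerset_insert ha, ← Finset.sum_add_distrib]
  refine Finset.sum_congr rfl fun B hB => ?_
  have hBA : B ⊆ A := Finset.mem_powerset.1 hB
  have haB : a ∉ B := fun h => ha (hBA h)
  rw [Finset.sum_insert ha, Finset.sum_insert ha]
  have h1 : sgnf B a = -1 := by simp [sgnf, haB]
  have h2 : sgnf (insert a B) a = 1 := by simp [sgnf]
  have h3 : ∑ j ∈ A, sgnf (insert a B) j • w j = ∑ j ∈ A, sgnf B j • w j := by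
    refine Finset.sum_congr rfl fun j hj => ?_
    have : j ≠ a := fun h => ha (h ▸ hj)
    simp [sgnf, this]
  rw [h1, h2, h3]
  congr 2
  · rw [neg_one_smul]; abel
  · rw [one_smul]; abel

lemma sgn_second {J V : Type*} [NormedAddCommGroup V] [InnerProductSpace ℝ V] (w : J → V)
    (A : Finset J) :
    ∑ B ∈ A.powerset, ‖∑ j ∈ A, sgnf B j • w j‖ ^ 2 = 2 ^ #A * ∑ j ∈ A, ‖w j‖ ^ 2 := by
  classical
  induction A using Finset.induction_on with
  | empty => simp
  | insert a A ha ih =>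
    rw [sgn_step (fun v => ‖v‖ ^ 2) w a A ha]
    have : ∀ B ∈ A.powerset, ‖(∑ j ∈ A, sgnf B j • w j) - w a‖ ^ 2
        + ‖(∑ j ∈ A, sgnf B j • w j) + w a‖ ^ 2
        = 2 * ‖∑ j ∈ A, sgnf B j • w j‖ ^ 2 + 2 * ‖w a‖ ^ 2 := by
      intro B _
      have := parallelogram_law_with_norm ℝ (∑ j ∈ A, sgnf B j • w j) (w a)
      nlinarith
    rw [Finset.sum_congr rfl this, Finset.sum_add_distrib, ← Finset.mul_sum, ih,
      Finset.sum_const, Finset.card_powerset, Finset.card_insert_of_notMem ha,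
      Finset.sum_insert ha]
    simp only [nsmul_eq_mul]; push_cast; ring

lemma sgn_fourth {J : Type*} (w : J → ℝ) (A : Finset J) :
    ∑ B ∈ A.powerset, (∑ j ∈ A, sgnf B j • w j) ^ 4 ≤ 2 ^ #A * (3 * (∑ j ∈ A, w j ^ 2) ^ 2) := by
  classical
  induction A using Finset.induction_on with
  | empty => simp
  | insert a A ha ih =>
    rw [sgn_step (fun v => v ^ 4) w a A ha]
    have : ∀ B ∈ A.powerset, ((∑ j ∈ A, sgnf B j • w j) - w a) ^ 4
        + ((∑ j ∈ A, sgnf B j • w j) + w a) ^ 4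
        = 2 * (∑ j ∈ A, sgnf B j • w j) ^ 4 +
          (12 * w a ^ 2 * ‖∑ j ∈ A, sgnf B j • w j‖ ^ 2 + 2 * w a ^ 4) := by
      intro B _
      rw [Real.norm_eq_abs, sq_abs]; ring
    rw [Finset.sum_congr rfl this, Finset.sum_add_distrib, Finset.sum_add_distrib,
      ← Finset.mul_sum, ← Finset.mul_sum, sgn_second,
      Finset.sum_const, Finset.card_powerset, Finset.card_insert_of_notMem ha,
      Finset.sum_insert ha]
    simp only [nsmul_eq_mul, Real.norm_eq_abs, sq_abs]; push_cast
    have h2 : (0 : ℝ) < 2 ^ #A := by positivity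
    rw [pow_succ (2:ℝ) #A]
    have : (0:ℝ) ≤ 2 ^ #A * w a ^ 4 := by positivity
    nlinarith

/-- Khintchine. -/
lemma khin {J : Type*} (w : J → ℝ) (A : Finset J) :
    2 ^ #A * √(∑ j ∈ A, w j ^ 2) ≤ 2 * ∑ B ∈ A.powerset, |∑ j ∈ A, sgnf B j * w j| := by
  have h4 := sgn_fourth w A
  have h2 := sgn_second w A
  simp only [Real.norm_eq_abs, sq_abs, smul_eq_mul] at h2 h4
  set σ := √(∑ j ∈ A, w j ^ 2) with hσ
  have hs : ∑ j ∈ A, w j ^ 2 = σ ^ 2 := (Real.sq_sqrt (Finset.sum_nonneg fun _ _ => sq_nonneg _)).symm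
  rw [hs] at h2 h4
  have hσ0 : 0 ≤ σ := Real.sqrt_nonneg _
  rcases hσ0.eq_or_lt with h | hpos
  · rw [← h]; simp; exact Finset.sum_nonneg fun _ _ => abs_nonneg _
  -- pointwise: with t = |s| / (c σ), c = 3/2 : 2 t ≥ 3 t^2 - t^4
  have key : ∀ s : ℝ, 3 * s ^ 2 * ((3/2) * σ) ^ 2 - s ^ 4 ≤ 2 * |s| * ((3/2) * σ) ^ 3 := by
    intro s
    have e2 : s ^ 2 = |s| ^ 2 := (sq_abs s).symm
    have e4 : s ^ 4 = |s| ^ 4 := by rw [show s ^ 4 = (s ^ 2) ^ 2 by ring, e2]; ring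
    rw [e2, e4]
    have ht := abs_nonneg s
    set t := |s|
    set l := (3/2) * σ
    have hl : 0 < l := by positivity
    have : 0 ≤ t * ((t - l) ^ 2 * (t + 2 * l)) := by positivity
    nlinarith
  have hsum := Finset.sum_le_sum (s := A.powerset) fun B _ => key (∑ j ∈ A, sgnf B j * w j)
  rw [Finset.sum_sub_distrib, ← Finset.sum_mul, ← Finset.mul_sum, ← Finset.sum_mul,
    ← Finset.mul_sum, h2] at hsum
  set E := ∑ B ∈ A.powerset, |∑ j ∈ A, sgnf B j * w j|
  have hp : (0 : ℝ) < 2 ^ #A := by positivity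
  set P : ℝ := 2 ^ #A
  have h3 : 0 < σ ^ 3 := by positivity
  have : P * σ * σ ^ 3 ≤ 2 * E * σ ^ 3 := by
    have hE : 0 ≤ E * σ ^ 3 := mul_nonneg (Finset.sum_nonneg fun _ _ => abs_nonneg _) h3.le
    have hP : 0 ≤ P * σ ^ 4 := by positivity
    nlinarith
  exact le_of_mul_le_mul_right this h3

lemma sgn_orth {J : Type*} [DecidableEq J] (A : Finset J) {j k : J} (hj : j ∈ A) (hjk : j ≠ k) :
    ∑ B ∈ A.powerset, sgnf B k * sgnf B j = 0 := by
  have hA : A = insert j (A.erase j) := (Finset.insert_erase hj).symm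
  rw [hA, Finset.sum_powerset_insert (Finset.notMem_erase j A), ← Finset.sum_add_distrib]
  refine Finset.sum_eq_zero fun B hB => ?_
  have : j ∉ B := fun h => Finset.notMem_erase j A (Finset.mem_powerset.1 hB h)
  simp only [sgnf, this, hjk.symm, Finset.mem_insert, false_or, true_or, if_true, if_false]
  split_ifs <;> simp

end signs

section basis

variable {X : Type*} [NormedAddCommGroup X] [NormedSpace ℝ X]

/-- Data of an unconditional basis with continuous coordinates. -/
structure UB {J : Type*} (x : J → X) (c : J → X →L[ℝ] ℝ) (K : ℝ) : Prop where
  hK : 1 ≤ K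
  hs : ∀ f, HasSum (fun j => c j f • x j) f
  hself : ∀ j, c j (x j) = 1
  hne : ∀ j k, j ≠ k → c j (x k) = 0
  hm : ∀ (f : X) (A : Finset J) (m : J → ℝ), (∀ j ∈ A, |m j| ≤ 1) →
    ‖∑ j ∈ A, (m j * c j f) • x j‖ ≤ K * ‖f‖

lemma exists_UB [CompleteSpace X] {J : Type*} (x : J → X) (hnorm : ∀ j, ‖x j‖ = 1)
    (hbasis : ∀ f : X, ∃! a : J → ℝ, HasSum (fun j => a j • x j) f) :
    ∃ (c : J → X →L[ℝ] ℝ) (K : ℝ), UB x c K := by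
  classical
  choose a ha hu using hbasis
  simp only at ha hu
  have hu' : ∀ f b, HasSum (fun j => b j • x j) f → b = a f := hu
  have hadd : ∀ f g, a (f + g) = a f + a g := by
    intro f g
    refine (hu' _ _ ?_).symm
    simpa [add_smul] using (ha f).add (ha g)
  have hsmul : ∀ (r : ℝ) f, a (r • f) = r • a f := by
    intro r f
    refine (hu' _ _ ?_).symm
    simpa [mul_smul] using (ha f).const_smul r
  -- bounded partial sums
  have hbd : ∀ f, ∃ C, ∀ A : Finset J, ‖∑ j ∈ A, a f j • x j‖ ≤ C := by
    intro f
    obtain ⟨s, hs⟩ := (summable_iff_vanishing_norm.1 (ha f).summable) 1 one_pos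
    refine ⟨∑ j ∈ s, ‖a f j • x j‖ + 1, fun A => ?_⟩
    rw [← Finset.sum_inter_add_sum_sdiff A s]
    refine (norm_add_le _ _).trans (add_le_add ?_ (hs _ ?_).le)
    · refine (norm_sum_le _ _).trans ?_
      exact Finset.sum_le_sum_of_subset_of_nonneg Finset.inter_subset_right
        fun _ _ _ => norm_nonneg _
    · exact Finset.sdiff_disjoint
  let S : X →ₗ[ℝ] lp (fun _ : Finset J => X) ∞ :=
    { toFun := fun f => ⟨fun A => ∑ j ∈ A, a f j • x j, by
        obtain ⟨C, hC⟩ := hbd f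
        refine memℓp_infty ⟨C, ?_⟩
        rintro _ ⟨A, rfl⟩
        exact hC A⟩
      map_add' := by
        intro f g
        ext A
        simp [hadd, add_smul, Finset.sum_add_distrib]
        rfl
      map_smul' := by
        intro r f
        ext A
        simp [hsmul, mul_smul, Finset.smul_sum] }
  have hS : ∀ f A, (S f : Finset J → X) A = ∑ j ∈ A, a f j • x j := fun _ _ => rfl
  have hcont : Continuous S := by
    refine LinearMap.continuous_of_seq_closed_graph S ?_
    intro u f g huf hug
    have hA : ∀ A, Tendsto (fun n => ∑ j ∈ A, a (u n) j • x j) atTop (𝓝 ((g : Finset J → X) A)) := by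
      intro A
      rw [tendsto_iff_norm_sub_tendsto_zero] at hug ⊢
      refine squeeze_zero (fun _ => norm_nonneg _) (fun n => ?_) hug
      have := lp.norm_apply_le_norm ENNReal.top_ne_zero (S (u n) - g) A
      simpa [hS] using this
    have hc : ∀ j, ∃ r, Tendsto (fun n => a (u n) j) atTop (𝓝 r) := by
      intro j
      apply cauchySeq_tendsto_of_complete
      have h1 := (hA {j}).cauchySeq
      simp only [Finset.sum_singleton] at h1
      rw [Metric.cauchySeq_iff] at h1 ⊢
      intro ε hε
      obtain ⟨N, hN⟩ := h1 ε hε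
      refine ⟨N, fun m hm n hn => ?_⟩
      have := hN m hm n hn
      rwa [dist_eq_norm, ← sub_smul, norm_smul, hnorm, mul_one, ← dist_eq_norm] at this
    choose r hr using hc
    have hg : ∀ A, (g : Finset J → X) A = ∑ j ∈ A, r j • x j := by
      intro A
      refine tendsto_nhds_unique (hA A) ?_
      exact tendsto_finsetSum _ fun j _ => (hr j).smul_const (x j)
    have hsum : HasSum (fun j => r j • x j) f := by
      rw [HasSum, SummationFilter.unconditional_filter, Metric.tendsto_atTop]
      intro ε hε
      rw [Metric.tendsto_atTop] at huf hug
      obtain ⟨N1, hN1⟩ := huf (ε/3) (by positivity)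
      obtain ⟨N2, hN2⟩ := hug (ε/3) (by positivity)
      set n := max N1 N2
      have h1 := hN1 n (le_max_left _ _)
      have h2 := hN2 n (le_max_right _ _)
      have h3 := ha (u n)
      rw [HasSum, SummationFilter.unconditional_filter, Metric.tendsto_atTop] at h3
      obtain ⟨A0, hA0⟩ := h3 (ε/3) (by positivity)
      refine ⟨A0, fun A hAA => ?_⟩
      have h4 := hA0 A hAA
      have h5 : dist (∑ j ∈ A, r j • x j) (∑ j ∈ A, a (u n) j • x j) < ε / 3 := by
        refine lt_of_le_of_lt ?_ h2
        rw [← hg A, dist_comm, dist_eq_norm, dist_eq_norm]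
        exact lp.norm_apply_le_norm ENNReal.top_ne_zero (S (u n) - g) A
      calc dist (∑ j ∈ A, r j • x j) f ≤ _ := dist_triangle4 _ (∑ j ∈ A, a (u n) j • x j) (u n) _
        _ < ε := by linarith
    have hrf := hu' _ _ hsum
    ext A
    rw [hg, hS, hrf]
  let S' : X →L[ℝ] lp (fun _ : Finset J => X) ∞ := ⟨S, hcont⟩
  have hP : ∀ f (A : Finset J), ‖∑ j ∈ A, a f j • x j‖ ≤ ‖S'‖ * ‖f‖ := by
    intro f A
    refine le_trans ?_ (S'.le_opNorm f)
    exact lp.norm_apply_le_norm ENNReal.top_ne_zero (S f) A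
  let c : J → X →L[ℝ] ℝ := fun j => LinearMap.mkContinuous
    { toFun := fun f => a f j
      map_add' := by intro f g; simp [hadd]
      map_smul' := by intro f g; simp [hsmul] } ‖S'‖ (by
        intro f
        have := hP f {j}
        simpa [norm_smul, hnorm] using this)
  have hc : ∀ j f, c j f = a f j := fun _ _ => rfl
  have hx : ∀ k, a (x k) = Pi.single k 1 := by
    intro k
    refine (hu' _ _ ?_).symm
    convert hasSum_ite_eq k (x k) using 2 with j
    by_cases h : j = k
    · subst h; simp
    · simp [h]
  refine ⟨c, 1 + 2 * ‖S'‖, by linarith [norm_nonneg S'], ha, ?_, ?_, ?_⟩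
  · intro j; simp [hc, hx]
  · intro j k h; simp [hc, hx, h]
  · intro f A m hm
    refine NormedSpace.norm_le_dual_bound ℝ _ (by positivity) fun g => ?_
    have hBg : ∀ B : Finset J, |∑ j ∈ B, a f j * g (x j)| ≤ ‖S'‖ * ‖f‖ * ‖g‖ := by
      intro B
      have h1 : ∑ j ∈ B, a f j * g (x j) = g (∑ j ∈ B, a f j • x j) := by simp
      rw [h1, mul_comm]
      exact (g.le_opNorm _).trans (mul_le_mul_of_nonneg_left (hP f B) (norm_nonneg _))
    have h2 : ∑ j ∈ A, |a f j * g (x j)| ≤ 2 * (‖S'‖ * ‖f‖ * ‖g‖) := by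
      rw [← Finset.sum_filter_add_sum_filter_not A (fun j => 0 ≤ a f j * g (x j)), two_mul]
      refine add_le_add ?_ ?_
      · refine le_trans (le_of_eq ?_) ((le_abs_self _).trans
          (hBg (A.filter (fun j => 0 ≤ a f j * g (x j)))))
        exact Finset.sum_congr rfl fun j hj => abs_of_nonneg (Finset.mem_filter.1 hj).2
      · refine le_trans (le_of_eq ?_) ((neg_le_abs _).trans
          (hBg (A.filter (fun j => ¬ 0 ≤ a f j * g (x j)))))
        rw [← Finset.sum_neg_distrib]
        exact Finset.sum_congr rfl fun j hj =>
          abs_of_neg (not_le.1 (Finset.mem_filter.1 hj).2)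
    have h3 : g (∑ j ∈ A, (m j * c j f) • x j) = ∑ j ∈ A, m j * (a f j * g (x j)) := by
      simp [hc, mul_assoc]
    rw [h3, Real.norm_eq_abs]
    refine (Finset.abs_sum_le_sum_abs _ _).trans ?_
    have h4 : ∑ j ∈ A, |m j * (a f j * g (x j))| ≤ ∑ j ∈ A, |a f j * g (x j)| := by
      refine Finset.sum_le_sum fun j hj => ?_
      rw [abs_mul]
      exact mul_le_of_le_one_left (abs_nonneg _) (hm j hj)
    have : 0 ≤ ‖f‖ * ‖g‖ := by positivity
    nlinarith

variable {J : Type*} {x : J → X} {c : J → X →L[ℝ] ℝ} {K : ℝ}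

lemma UB.coord_sum (h : UB x c K) (A : Finset J) (a : J → ℝ) {j : J} (hj : j ∈ A) :
    c j (∑ k ∈ A, a k • x k) = a j := by
  classical
  rw [map_sum, Finset.sum_eq_single_of_mem j hj]
  · simp [h.hself]
  · intro k _ hk; simp [h.hne j k hk.symm]

/-- multipliers on finite sums -/
lemma UB.mult (h : UB x c K) {A B : Finset J} (hBA : B ⊆ A) (a m : J → ℝ)
    (hm : ∀ j ∈ B, |m j| ≤ 1) :
    ‖∑ j ∈ B, (m j * a j) • x j‖ ≤ K * ‖∑ j ∈ A, a j • x j‖ := by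
  have := h.hm (∑ j ∈ A, a j • x j) B m hm
  rwa [Finset.sum_congr rfl fun j hj => by rw [h.coord_sum A a (hBA hj)]] at this

lemma UB.proj (h : UB x c K) {A B : Finset J} (hBA : B ⊆ A) (a : J → ℝ) :
    ‖∑ j ∈ B, a j • x j‖ ≤ K * ‖∑ j ∈ A, a j • x j‖ := by
  simpa using h.mult hBA a (fun _ => 1) (by simp)

lemma UB.projf (h : UB x c K) (B : Finset J) (f : X) :
    ‖∑ j ∈ B, c j f • x j‖ ≤ K * ‖f‖ := by
  simpa using h.hm f B (fun _ => 1) (by simp)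

/-- comparison map -/
lemma UB.exists_map [CompleteSpace X] {Y : Type*} [NormedAddCommGroup Y] [NormedSpace ℝ Y] [CompleteSpace Y]
    (c : J → X →L[ℝ] ℝ) (hs : ∀ f, HasSum (fun j => c j f • x j) f)
    (hself : ∀ j, c j (x j) = 1) (hne : ∀ j k, j ≠ k → c j (x k) = 0)
    (y : J → Y) (C : ℝ) (hC : 0 < C)
    (hxy : ∀ (A : Finset J) (a : J → ℝ), ‖∑ j ∈ A, a j • y j‖ ≤ C * ‖∑ j ∈ A, a j • x j‖) :
    ∃ S : X →L[ℝ] Y, ∀ j, S (x j) = y j := by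
  have hsm : ∀ f, Summable (fun j => c j f • y j) := by
    intro f
    rw [summable_iff_vanishing_norm]
    intro ε hε
    obtain ⟨s, hs'⟩ := summable_iff_vanishing_norm.1 (hs f).summable (ε / C) (by positivity)
    refine ⟨s, fun t ht => (hxy t _).trans_lt ?_⟩
    have := hs' t ht
    rwa [lt_div_iff₀' hC] at this
  refine ⟨LinearMap.mkContinuous
    { toFun := fun f => ∑' j, c j f • y j
      map_add' := by
        intro f g
        rw [← (hsm f).tsum_add (hsm g)]
        simp [add_smul]
      map_smul' := by
        intro r f
        rw [RingHom.id_apply, ← (hsm f).tsum_const_smul r]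
        simp [mul_smul] } C ?_, ?_⟩
  · intro f
    refine le_of_tendsto_of_tendsto (hsm f).hasSum.norm ((hs f).norm.const_mul C)
      (Eventually.of_forall fun A => hxy A _)
  · intro j
    change ∑' k, c k (x j) • y k = y j
    rw [tsum_eq_single j]
    · simp [hself]
    · intro k hk; simp [hne k j hk]

end basis

section l1l2

abbrev L1 := lp (fun _ : ℕ => ℝ) 1
abbrev L2 := lp (fun _ : ℕ => ℝ) 2

lemma l1_hasSum (u : L1) : HasSum (fun n => |u n|) ‖u‖ := by
  have := lp.hasSum_norm (p := 1) (by simp) u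
  simpa using this

lemma l1_le (u : L1) (F : Finset ℕ) : ∑ n ∈ F, |u n| ≤ ‖u‖ :=
  sum_le_hasSum F (fun _ _ => abs_nonneg _) (l1_hasSum u)

lemma l2_le (v : L2) (F : Finset ℕ) : ∑ n ∈ F, v n ^ 2 ≤ ‖v‖ ^ 2 := by
  have := lp.sum_rpow_le_norm_rpow (p := 2) (by simp) v F
  simpa using this

def E1 (n : ℕ) : L1 := lp.single 1 n (1 : ℝ)
def E2 (n : ℕ) : L2 := lp.single 2 n (1 : ℝ)

lemma l1_single (u : L1) : HasSum (fun n => u n • E1 n) u := by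
  have := lp.hasSum_single (p := 1) (by simp) u
  convert this using 2 with n
  rw [E1, ← lp.single_smul]; simp

lemma l2_single (u : L2) : HasSum (fun n => u n • E2 n) u := by
  have := lp.hasSum_single (p := 2) (by simp) u
  convert this using 2 with n
  rw [E2, ← lp.single_smul]; simp

lemma norm_E1 (n : ℕ) : ‖E1 n‖ = 1 := by
  rw [E1, lp.norm_single (by simp)]; simp

lemma norm_E2 (n : ℕ) : ‖E2 n‖ = 1 := by
  rw [E2, lp.norm_single (by simp)]; simp

lemma E1_apply (n m : ℕ) : (E1 n : ℕ → ℝ) m = if m = n then 1 else 0 := by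
  rw [E1, lp.single_apply]; split_ifs with h <;> simp [h]

lemma E2_apply (n m : ℕ) : (E2 n : ℕ → ℝ) m = if m = n then 1 else 0 := by
  rw [E2, lp.single_apply]; split_ifs with h <;> simp [h]

lemma norm_sum_E1 (F : Finset ℕ) (a : ℕ → ℝ) : ‖∑ n ∈ F, a n • E1 n‖ = ∑ n ∈ F, |a n| := by
  have := lp.norm_sum_single (E := fun _ : ℕ => ℝ) (p := 1) (by simp) a F
  simp only [ENNReal.toReal_one, Real.rpow_one, Real.norm_eq_abs] at this
  rw [← this]
  congr 1
  refine Finset.sum_congr rfl fun n _ => ?_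
  rw [E1, ← lp.single_smul]; simp

lemma norm_sum_E2 (F : Finset ℕ) (a : ℕ → ℝ) :
    ‖∑ n ∈ F, a n • E2 n‖ ^ 2 = ∑ n ∈ F, a n ^ 2 := by
  have := lp.norm_sum_single (E := fun _ : ℕ => ℝ) (p := 2) (by simp) a F
  simp only [ENNReal.toReal_ofNat, Real.rpow_ofNat, Real.norm_eq_abs, sq_abs] at this
  rw [← this]
  congr 2
  refine Finset.sum_congr rfl fun n _ => ?_
  rw [E2, ← lp.single_smul]; simp

lemma sum_apply1 {J : Type*} (A : Finset J) (g : J → L1) (n : ℕ) :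
    (∑ j ∈ A, g j : L1) n = ∑ j ∈ A, g j n := by
  rw [lp.coeFn_sum, Finset.sum_apply]

/-- square function lower bound -/
lemma sq_fun {J : Type*} (A : Finset J) (u : J → L1) (R : ℝ)
    (hR : ∀ B : Finset J, ‖∑ j ∈ A, sgnf B j • u j‖ ≤ R) (F : Finset ℕ) :
    ∑ n ∈ F, √(∑ j ∈ A, (u j n) ^ 2) ≤ 2 * R := by
  have hp : (0 : ℝ) < 2 ^ #A := by positivity
  refine le_of_mul_le_mul_left ?_ hp
  calc 2 ^ #A * ∑ n ∈ F, √(∑ j ∈ A, (u j n) ^ 2)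
      = ∑ n ∈ F, 2 ^ #A * √(∑ j ∈ A, (u j n) ^ 2) := Finset.mul_sum _ _ _
    _ ≤ ∑ n ∈ F, 2 * ∑ B ∈ A.powerset, |∑ j ∈ A, sgnf B j * u j n| :=
        Finset.sum_le_sum fun n _ => khin (fun j => u j n) A
    _ = 2 * ∑ B ∈ A.powerset, ∑ n ∈ F, |(∑ j ∈ A, sgnf B j • u j : L1) n| := by
        rw [← Finset.mul_sum, Finset.sum_comm]
        simp only [sum_apply1, lp.coeFn_smul, Pi.smul_apply, smul_eq_mul]
    _ ≤ 2 * ∑ B ∈ A.powerset, R := by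
        gcongr with B hB
        exact (l1_le _ F).trans (hR B)
    _ = 2 ^ #A * (2 * R) := by
        rw [Finset.sum_const, Finset.card_powerset, nsmul_eq_mul]; push_cast; ring

lemma minkow {J : Type*} (A : Finset J) (F : Finset ℕ) (w : J → ℕ → ℝ) :
    √(∑ j ∈ A, (∑ n ∈ F, w j n) ^ 2) ≤ ∑ n ∈ F, √(∑ j ∈ A, w j n ^ 2) := by
  have := norm_sum_le F (fun n => (WithLp.toLp 2 (fun j : A => w j n) : EuclideanSpace ℝ A))
  simp only [EuclideanSpace.norm_eq, Real.norm_eq_abs, sq_abs, WithLp.ofLp_sum, Finset.sum_apply] at this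
  simp only [Finset.sum_coe_sort A (fun j => (∑ n ∈ F, w j n) ^ 2),
    fun n => Finset.sum_coe_sort A (fun j => w j n ^ 2)] at this
  exact this

lemma minkow_norm {J : Type*} (A : Finset J) (u : J → L1) (R : ℝ) (hR0 : 0 ≤ R)
    (hR : ∀ B : Finset J, ‖∑ j ∈ A, sgnf B j • u j‖ ≤ R) :
    ∑ j ∈ A, ‖u j‖ ^ 2 ≤ (2 * R) ^ 2 := by
  have ht : Tendsto (fun F : Finset ℕ => ∑ j ∈ A, (∑ n ∈ F, |u j n|) ^ 2) atTop
      (𝓝 (∑ j ∈ A, ‖u j‖ ^ 2)) := by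
    refine tendsto_finsetSum _ fun j _ => ?_
    exact (l1_hasSum (u j)).pow 2
  refine le_of_tendsto ht (Eventually.of_forall fun F => ?_)
  have h1 := minkow A F (fun j n => |u j n|)
  simp only [sq_abs] at h1
  have h2 := h1.trans (sq_fun A u R hR F)
  exact (Real.sqrt_le_left (by positivity)).1 h2

variable {J : Type*} {x : J → L1 × L2} {c : J → L1 × L2 →L[ℝ] ℝ} {K : ℝ}

lemma UB.sgn (h : UB x c K) (A : Finset J) (a : J → ℝ) (B : Finset J) :
    ‖∑ j ∈ A, sgnf B j • a j • x j‖ ≤ K * ‖∑ j ∈ A, a j • x j‖ := by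
  simpa [mul_smul] using h.mult subset_rfl a (sgnf B) (fun j _ => (abs_sgnf B j).le)

lemma UB.sgn1 (h : UB x c K) (A : Finset J) (a : J → ℝ) (B : Finset J) :
    ‖∑ j ∈ A, sgnf B j • a j • (x j).1‖ ≤ K * ‖∑ j ∈ A, a j • x j‖ := by
  refine le_trans (le_of_eq_of_le ?_ (norm_fst_le _)) (h.sgn A a B)
  simp [Prod.fst_sum]

lemma UB.sgn2 (h : UB x c K) (A : Finset J) (a : J → ℝ) (B : Finset J) :
    ‖∑ j ∈ A, sgnf B j • a j • (x j).2‖ ≤ K * ‖∑ j ∈ A, a j • x j‖ := by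
  refine le_trans (le_of_eq_of_le ?_ (norm_snd_le _)) (h.sgn A a B)
  simp [Prod.snd_sum]

lemma UB.cot (h : UB x c K) (hnorm : ∀ j, ‖x j‖ = 1) (A : Finset J) (a : J → ℝ) :
    ∑ j ∈ A, a j ^ 2 ≤ 5 * (K * ‖∑ j ∈ A, a j • x j‖) ^ 2 := by
  have hK := h.hK
  set R := K * ‖∑ j ∈ A, a j • x j‖ with hRdef
  have hR : 0 ≤ R := by positivity
  have h1 := minkow_norm A (fun j => a j • (x j).1) R hR (h.sgn1 A a)
  have h2 : ∑ j ∈ A, ‖a j • (x j).2‖ ^ 2 ≤ R ^ 2 := by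
    have h3 := sgn_second (fun j => a j • (x j).2) A
    have hp : (0 : ℝ) < 2 ^ #A := by positivity
    refine le_of_mul_le_mul_left ?_ hp
    rw [← h3]
    calc _ ≤ ∑ B ∈ A.powerset, R ^ 2 := by
          refine Finset.sum_le_sum fun B _ => ?_
          exact pow_le_pow_left₀ (norm_nonneg _) (h.sgn2 A a B) 2
      _ = _ := by rw [Finset.sum_const, Finset.card_powerset, nsmul_eq_mul]; push_cast; ring
  have h4 : ∑ j ∈ A, a j ^ 2 ≤ ∑ j ∈ A, ‖a j • (x j).1‖ ^ 2 + ∑ j ∈ A, ‖a j • (x j).2‖ ^ 2 := by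
    rw [← Finset.sum_add_distrib]
    refine Finset.sum_le_sum fun j _ => ?_
    have hj := hnorm j
    rw [Prod.norm_def] at hj
    rw [norm_smul, norm_smul, mul_pow, mul_pow, ← mul_add, Real.norm_eq_abs, sq_abs]
    refine le_mul_of_one_le_right (sq_nonneg _) ?_
    rcases max_choice ‖(x j).1‖ ‖(x j).2‖ with h | h <;> rw [h] at hj <;> rw [hj] <;> nlinarith [sq_nonneg ‖(x j).1‖, sq_nonneg ‖(x j).2‖]
  linarith

lemma UB.cotf (h : UB x c K) (hnorm : ∀ j, ‖x j‖ = 1) (A : Finset J) (f : L1 × L2) :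
    ∑ j ∈ A, (c j f) ^ 2 ≤ 5 * (K ^ 2 * ‖f‖) ^ 2 := by
  have hK := h.hK
  refine (h.cot hnorm A _).trans ?_
  have := h.projf A f
  rw [sq K, mul_assoc]
  gcongr

/-- The `ℓ₁` part. -/
lemma UB.part1 (h : UB x c K) (hnorm : ∀ j, ‖x j‖ = 1) (A : Finset J) (a : J → ℝ)
    (hA : ∀ j ∈ A, 1 / 2 ≤ |c j ((x j).1, 0)|) :
    ∑ j ∈ A, |a j| ≤ 12 * K ^ 3 * ‖∑ j ∈ A, a j • x j‖ := by
  have hK := h.hK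
  set R := K * ‖∑ j ∈ A, a j • x j‖ with hRdef
  have hR : 0 ≤ R := by positivity
  have hsq := sq_fun A (fun j => a j • (x j).1) R (h.sgn1 A a)
  -- signs
  obtain ⟨s, hs1, hs2⟩ : ∃ s : J → ℝ, (∀ j, |s j| = |a j|) ∧
      ∀ j, s j * c j ((x j).1, 0) = |a j| * |c j ((x j).1, 0)| := by
    refine ⟨fun j => |a j| * (if 0 ≤ c j ((x j).1, 0) then 1 else -1), ?_, ?_⟩
    · intro j; dsimp only; split_ifs <;> simp
    · intro j; dsimp only; split_ifs with hh
      · rw [abs_of_nonneg hh]; ring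
      · rw [abs_of_neg (not_le.1 hh)]; ring
  have hc : ∀ j, HasSum (fun n => (x j).1 n * c j (E1 n, 0)) (c j ((x j).1, 0)) := by
    intro j
    have := (l1_single (x j).1).mapL ((c j).comp (ContinuousLinearMap.inl ℝ L1 L2))
    simpa using this
  have ht : HasSum (fun n => ∑ j ∈ A, s j * ((x j).1 n * c j (E1 n, 0)))
      (∑ j ∈ A, s j * c j ((x j).1, 0)) :=
    hasSum_sum fun j _ => (hc j).mul_left (s j)
  have hb : ∑ j ∈ A, s j * c j ((x j).1, 0) ≤ 2 * R * (3 * K ^ 2) := by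
    refine le_of_tendsto ht (Eventually.of_forall fun F => ?_)
    refine le_trans ?_ (mul_le_mul_of_nonneg_right (hsq F) (by positivity))
    rw [Finset.sum_mul]
    refine Finset.sum_le_sum fun n _ => ?_
    have e1 : ∑ j ∈ A, s j * ((x j).1 n * c j (E1 n, 0))
        = ∑ j ∈ A, (s j * (x j).1 n) * c j (E1 n, 0) :=
      Finset.sum_congr rfl fun j _ => by ring
    rw [e1]
    refine (Real.sum_mul_le_sqrt_mul_sqrt A _ _).trans ?_
    refine mul_le_mul (le_of_eq ?_) ?_ (Real.sqrt_nonneg _) (Real.sqrt_nonneg _)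
    · congr 1
      refine Finset.sum_congr rfl fun j _ => ?_
      have : s j ^ 2 = a j ^ 2 := by rw [← sq_abs, hs1, sq_abs]
      simp [mul_pow, this]
    · refine Real.sqrt_le_iff.2 ⟨by positivity, (h.cotf hnorm A _).trans ?_⟩
      have : ‖((E1 n, 0) : L1 × L2)‖ = 1 := by simp [Prod.norm_def, norm_E1]
      rw [this]
      nlinarith [sq_nonneg (K^2)]
  have hl : (1/2) * ∑ j ∈ A, |a j| ≤ ∑ j ∈ A, s j * c j ((x j).1, 0) := by
    rw [Finset.mul_sum]
    refine Finset.sum_le_sum fun j hj => ?_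
    rw [hs2, mul_comm]
    exact mul_le_mul_of_nonneg_left (hA j hj) (abs_nonneg _)
  have : 12 * K ^ 3 * ‖∑ j ∈ A, a j • x j‖ = 2 * (2 * R * (3 * K ^ 2)) := by rw [hRdef]; ring
  linarith

/-- The `ℓ₂` part. -/
lemma UB.part2 (h : UB x c K) (hnorm : ∀ j, ‖x j‖ = 1) (A : Finset J) (a : J → ℝ)
    (hA : ∀ j ∈ A, 1 / 2 ≤ |c j (0, (x j).2)|) :
    ‖∑ j ∈ A, a j • x j‖ ≤ 2 * K ^ 2 * √(∑ j ∈ A, a j ^ 2) := by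
  classical
  have hK := h.hK
  have hp : (0 : ℝ) < 2 ^ #A := by positivity
  set v : Finset J → L1 × L2 := fun B => (0, ∑ j ∈ A, sgnf B j • a j • (x j).2) with hv
  set D := ∑ k ∈ A, (c k (0, (x k).2) * a k) • x k with hD
  have hcv : ∀ B k, c k (v B) = ∑ j ∈ A, sgnf B j * (a j * c k (0, (x j).2)) := by
    intro B k
    have : v B = ∑ j ∈ A, sgnf B j • a j • ((0, (x j).2) : L1 × L2) := by
      rw [hv]; ext1 <;> simp [Prod.fst_sum, Prod.snd_sum]
    rw [this]; simp only [map_sum, map_smul, smul_eq_mul]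
  have hsum : (2 ^ #A : ℝ) • D = ∑ B ∈ A.powerset, ∑ k ∈ A, (sgnf B k * c k (v B)) • x k := by
    rw [Finset.sum_comm, hD, Finset.smul_sum]
    refine Finset.sum_congr rfl fun k hk => ?_
    rw [← Finset.sum_smul, smul_smul]
    congr 1
    simp only [hcv, Finset.mul_sum]
    rw [Finset.sum_comm, Finset.sum_eq_single_of_mem k hk]
    · simp only [← mul_assoc, sgnf_mul_self]
      rw [Finset.sum_const, Finset.card_powerset, nsmul_eq_mul]; push_cast; ring
    · intro j hj hjk
      simp only [← mul_assoc]
      rw [← Finset.sum_mul, ← Finset.sum_mul, sgn_orth A hj hjk]; simp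
  have hvs : ∑ B ∈ A.powerset, ‖v B‖ ^ 2 ≤ 2 ^ #A * ∑ j ∈ A, a j ^ 2 := by
    have h3 := sgn_second (fun j => a j • (x j).2) A
    have e : ∀ B, ‖v B‖ = ‖∑ j ∈ A, sgnf B j • a j • (x j).2‖ := by
      intro B; simp [hv, Prod.norm_def]
    simp only [e]
    rw [h3]
    refine mul_le_mul_of_nonneg_left (Finset.sum_le_sum fun j hj => ?_) hp.le
    have : ‖(x j).2‖ ≤ 1 := (norm_snd_le _).trans (hnorm j).le
    rw [norm_smul, mul_pow, Real.norm_eq_abs, sq_abs]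
    exact mul_le_of_le_one_right (sq_nonneg _) (pow_le_one₀ (norm_nonneg _) this)
  have hvs2 : ∑ B ∈ A.powerset, ‖v B‖ ≤ 2 ^ #A * √(∑ j ∈ A, a j ^ 2) := by
    have h4 := Real.sum_mul_le_sqrt_mul_sqrt A.powerset (fun _ => (1 : ℝ)) (fun B => ‖v B‖)
    simp only [one_mul, one_pow, Finset.sum_const, Finset.card_powerset, nsmul_eq_mul,
      mul_one] at h4
    refine h4.trans ?_
    push_cast
    calc √(2 ^ #A) * √(∑ B ∈ A.powerset, ‖v B‖ ^ 2)
        ≤ √(2 ^ #A) * √(2 ^ #A * ∑ j ∈ A, a j ^ 2) := by gcongr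
      _ = _ := by
        rw [Real.sqrt_mul hp.le, ← mul_assoc, Real.mul_self_sqrt hp.le]
  have hDn : ‖D‖ ≤ K * √(∑ j ∈ A, a j ^ 2) := by
    refine le_of_mul_le_mul_left ?_ hp
    have : 2 ^ #A * ‖D‖ = ‖(2 ^ #A : ℝ) • D‖ := by
      rw [norm_smul, Real.norm_of_nonneg hp.le]
    rw [this, hsum]
    refine (norm_sum_le _ _).trans ?_
    refine (Finset.sum_le_sum fun B _ =>
      h.hm (v B) A (sgnf B) fun j _ => (abs_sgnf B j).le).trans ?_
    rw [← Finset.mul_sum]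
    nlinarith
  have := h.mult subset_rfl (fun k => 2 * (c k (0, (x k).2) * a k))
    (fun k => (2 * c k (0, (x k).2))⁻¹) (A := A) (by
      intro j hj
      have := hA j hj
      rw [abs_inv, abs_mul, abs_two]
      exact inv_le_one_of_one_le₀ (by linarith))
  have e1 : ∑ j ∈ A, ((2 * c j (0, (x j).2))⁻¹ * (2 * (c j (0, (x j).2) * a j))) • x j
      = ∑ j ∈ A, a j • x j := by
    refine Finset.sum_congr rfl fun j hj => ?_
    have h0 : c j (0, (x j).2) ≠ 0 := by
      intro h0; have := hA j hj; rw [h0] at this; norm_num at this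
    congr 1
    field_simp
  have e2 : ∑ j ∈ A, (2 * (c j (0, (x j).2) * a j)) • x j = (2 : ℝ) • D := by
    rw [hD, Finset.smul_sum]; simp only [mul_smul]
  rw [e1, e2, norm_smul, Real.norm_of_nonneg zero_le_two] at this
  refine this.trans ?_
  calc K * (2 * ‖D‖) ≤ K * (2 * (K * √(∑ j ∈ A, a j ^ 2))) := by gcongr
    _ = _ := by ring

lemma UB.split (h : UB x c K) (j : J) : c j ((x j).1, 0) + c j (0, (x j).2) = 1 := by
  rw [← map_add, ← h.hself j]; simp

lemma UB.split' (h : UB x c K) (j : J) (hj : ¬ 1 / 2 ≤ |c j ((x j).1, 0)|) :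
    1 / 2 ≤ |c j (0, (x j).2)| := by
  have := h.split j
  rw [not_le, abs_lt] at hj
  exact le_trans (by linarith) (le_abs_self _)

end l1l2

section final

variable {J : Type*} {x : J → L1 × L2} {c : J → L1 × L2 →L[ℝ] ℝ} {K : ℝ}

lemma UB.countable (h : UB x c K) (hnorm : ∀ j, ‖x j‖ = 1) : Countable J := by
  have hsupp : ∀ f, (Function.support (fun j => c j f • x j)).Countable := fun f =>
    (h.hs f).summable.countable_support
  have hcov : (Set.univ : Set J) ⊆ (⋃ n, Function.support (fun j => c j (E1 n, 0) • x j)) ∪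
      (⋃ n, Function.support (fun j => c j (0, E2 n) • x j)) := by
    intro j _
    by_contra hj
    have hx0 : x j ≠ 0 := by
      intro h0; have := hnorm j; rw [h0] at this; simp at this
    simp only [Set.mem_union, Set.mem_iUnion, Function.mem_support, not_or, not_exists, not_not,
      smul_eq_zero, hx0, or_false] at hj
    have h1 := (l1_single (x j).1).mapL ((c j).comp (ContinuousLinearMap.inl ℝ L1 L2))
    have h2 := (l2_single (x j).2).mapL ((c j).comp (ContinuousLinearMap.inr ℝ L1 L2))
    simp only [map_smul, ContinuousLinearMap.comp_apply, ContinuousLinearMap.inl_apply,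
      ContinuousLinearMap.inr_apply, hj.1, hj.2, smul_zero] at h1 h2
    have e1 := h1.unique hasSum_zero
    have e2 := h2.unique hasSum_zero
    have := h.split j
    rw [e1, e2] at this
    norm_num at this
  have : (Set.univ : Set J).Countable := Set.Countable.mono hcov
    ((Set.countable_iUnion fun n => hsupp _).union (Set.countable_iUnion fun n => hsupp _))
  exact Set.countable_univ_iff.1 this

lemma UB.inf1 (h : UB x c K) (hnorm : ∀ j, ‖x j‖ = 1) :
    {j | 1 / 2 ≤ |c j ((x j).1, 0)|}.Infinite := by
  classical
  intro hfin
  have hK := h.hK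
  set M : ℝ := ((#hfin.toFinset : ℕ) : ℝ)
  set C : ℝ := M + 2 * K ^ 2 with hC
  have hC0 : 0 ≤ C := by positivity
  have hup : ∀ (A : Finset J) (a : J → ℝ), ‖∑ j ∈ A, a j • x j‖ ≤ C * √(∑ j ∈ A, a j ^ 2) := by
    intro A a
    set R := √(∑ j ∈ A, a j ^ 2) with hR
    have hR0 : 0 ≤ R := Real.sqrt_nonneg _
    rw [← Finset.sum_filter_add_sum_filter_not A (fun j => 1 / 2 ≤ |c j ((x j).1, 0)|)]
    refine (norm_add_le _ _).trans ?_
    rw [hC, add_mul]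
    refine add_le_add ?_ ?_
    · refine (norm_sum_le _ _).trans ?_
      have : ∀ j ∈ A.filter (fun j => 1 / 2 ≤ |c j ((x j).1, 0)|), ‖a j • x j‖ ≤ R := by
        intro j hj
        rw [norm_smul, hnorm, mul_one, Real.norm_eq_abs]
        refine Real.abs_le_sqrt ?_
        exact Finset.single_le_sum (f := fun j => a j ^ 2) (fun _ _ => sq_nonneg _)
          (Finset.mem_filter.1 hj).1
      refine (Finset.sum_le_card_nsmul _ _ _ this).trans ?_
      rw [nsmul_eq_mul]
      refine mul_le_mul_of_nonneg_right ?_ hR0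
      refine Nat.cast_le.2 (Finset.card_le_card fun j hj => ?_)
      simpa using (Finset.mem_filter.1 hj).2
    · refine (h.part2 hnorm _ a fun j hj => h.split' j (Finset.mem_filter.1 hj).2).trans ?_
      refine mul_le_mul_of_nonneg_left (Real.sqrt_le_sqrt ?_) (by positivity)
      exact Finset.sum_le_sum_of_subset_of_nonneg (Finset.filter_subset _ _)
        fun _ _ _ => sq_nonneg _
  have key : ∀ N : ℕ, (N : ℝ) ^ 2 ≤ C ^ 2 * (5 * K ^ 4) * N := by
    intro N
    set f : Finset ℕ → L1 × L2 := fun B => ∑ n ∈ Finset.range N, sgnf B n • (E1 n, 0) with hf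
    have hfn : ∀ B, ‖f B‖ = N := by
      intro B
      have e : f B = (∑ n ∈ Finset.range N, sgnf B n • E1 n, 0) := by
        rw [hf]; ext1 <;> simp [Prod.fst_sum, Prod.snd_sum]
      rw [e, Prod.norm_def]
      simp [norm_sum_E1, abs_sgnf]
    have hcf : ∀ j B, c j (f B) = ∑ n ∈ Finset.range N, sgnf B n • c j (E1 n, 0) := by
      intro j B; simp only [hf, map_sum, map_smul]
    have hA : ∀ A : Finset J, ∑ B ∈ (Finset.range N).powerset, ‖∑ j ∈ A, c j (f B) • x j‖ ^ 2
        ≤ 2 ^ N * (C ^ 2 * (5 * K ^ 4) * N) := by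
      intro A
      calc _ ≤ ∑ B ∈ (Finset.range N).powerset, C ^ 2 * ∑ j ∈ A, (c j (f B)) ^ 2 := by
            refine Finset.sum_le_sum fun B _ => ?_
            refine (pow_le_pow_left₀ (norm_nonneg _) (hup A _) 2).trans ?_
            rw [mul_pow, Real.sq_sqrt (Finset.sum_nonneg fun _ _ => sq_nonneg _)]
        _ = C ^ 2 * ∑ j ∈ A, (2 ^ N * ∑ n ∈ Finset.range N, (c j (E1 n, 0)) ^ 2) := by
            rw [← Finset.mul_sum, Finset.sum_comm]
            congr 1
            refine Finset.sum_congr rfl fun j _ => ?_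
            have := sgn_second (fun n => c j (E1 n, 0)) (Finset.range N)
            simp only [Real.norm_eq_abs, sq_abs, Finset.card_range] at this
            simp only [hcf]
            exact this
        _ = C ^ 2 * (2 ^ N * ∑ n ∈ Finset.range N, ∑ j ∈ A, (c j (E1 n, 0)) ^ 2) := by
            rw [← Finset.mul_sum, Finset.sum_comm]
        _ ≤ C ^ 2 * (2 ^ N * ∑ n ∈ Finset.range N, 5 * K ^ 4) := by
            refine mul_le_mul_of_nonneg_left (mul_le_mul_of_nonneg_left
              (Finset.sum_le_sum fun n _ => ?_) (by positivity)) (by positivity)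
            refine (h.cotf hnorm A _).trans (le_of_eq ?_)
            have : ‖((E1 n, 0) : L1 × L2)‖ = 1 := by simp [Prod.norm_def, norm_E1]
            rw [this]; ring
        _ = _ := by
            rw [Finset.sum_const, Finset.card_range, nsmul_eq_mul]; ring
    have ht : Tendsto (fun A : Finset J => ∑ B ∈ (Finset.range N).powerset,
        ‖∑ j ∈ A, c j (f B) • x j‖ ^ 2) atTop
        (𝓝 (∑ B ∈ (Finset.range N).powerset, ‖f B‖ ^ 2)) :=
      tendsto_finsetSum _ fun B _ => ((h.hs (f B)).norm).pow 2
    have := le_of_tendsto ht (Eventually.of_forall hA)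
    simp only [hfn, Finset.sum_const, Finset.card_powerset, Finset.card_range, nsmul_eq_mul] at this
    push_cast at this
    exact le_of_mul_le_mul_left this (by positivity)
  obtain ⟨N, hN⟩ := exists_nat_gt (C ^ 2 * (5 * K ^ 4))
  have h0 : 0 ≤ C ^ 2 * (5 * K ^ 4) := by positivity
  have := key N
  nlinarith

lemma UB.inf2 (h : UB x c K) (hnorm : ∀ j, ‖x j‖ = 1) :
    {j | ¬ 1 / 2 ≤ |c j ((x j).1, 0)|}.Infinite := by
  classical
  intro hfin
  have hK := h.hK
  set M : ℝ := ((#hfin.toFinset : ℕ) : ℝ)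
  set C : ℝ := 12 * K ^ 3 * K + M * (3 * K) with hC
  have hC0 : 0 ≤ C := by positivity
  have hup : ∀ (A : Finset J) (a : J → ℝ), ∑ j ∈ A, |a j| ≤ C * ‖∑ j ∈ A, a j • x j‖ := by
    intro A a
    set R := ‖∑ j ∈ A, a j • x j‖ with hR
    have hR0 : 0 ≤ R := norm_nonneg _
    rw [← Finset.sum_filter_add_sum_filter_not A (fun j => 1 / 2 ≤ |c j ((x j).1, 0)|)]
    rw [hC, add_mul]
    refine add_le_add ?_ ?_
    · refine (h.part1 hnorm _ a fun j hj => (Finset.mem_filter.1 hj).2).trans ?_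
      rw [mul_assoc (12 * K ^ 3) K R]
      exact mul_le_mul_of_nonneg_left (h.proj (Finset.filter_subset
        (fun j => 1 / 2 ≤ |c j ((x j).1, 0)|) A) a) (by positivity)
    · have : ∀ j ∈ A.filter (fun j => ¬ 1 / 2 ≤ |c j ((x j).1, 0)|), |a j| ≤ 3 * K * R := by
        intro j hj
        refine abs_le_of_sq_le_sq ?_ (by positivity)
        have h1 := Finset.single_le_sum (f := fun j => a j ^ 2) (fun _ _ => sq_nonneg _)
          (Finset.mem_filter.1 hj).1
        have h2 := h.cot hnorm A a
        have : 0 ≤ (K * R) ^ 2 := sq_nonneg _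
        nlinarith
      refine (Finset.sum_le_card_nsmul _ _ _ this).trans ?_
      rw [nsmul_eq_mul, mul_assoc M]
      refine mul_le_mul_of_nonneg_right ?_ (by positivity)
      refine Nat.cast_le.2 (Finset.card_le_card fun j hj => ?_)
      simpa using (Finset.mem_filter.1 hj).2
  have key : ∀ N : ℕ, (N : ℝ) ≤ 2 * (C * (K * √N)) := by
    intro N
    set f : Finset ℕ → L1 × L2 := fun B => ∑ n ∈ Finset.range N, sgnf B n • (0, E2 n) with hf
    have hfn : ∀ B, ‖f B‖ = √N := by
      intro B
      have e : f B = (0, ∑ n ∈ Finset.range N, sgnf B n • E2 n) := by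
        rw [hf]; ext1 <;> simp [Prod.fst_sum, Prod.snd_sum]
      have e2 := norm_sum_E2 (Finset.range N) (sgnf B)
      simp only [pow_two, sgnf_mul_self, Finset.sum_const, Finset.card_range, nsmul_eq_mul,
        mul_one] at e2
      rw [e, Prod.norm_def, ← e2, Real.sqrt_mul_self (norm_nonneg _)]
      simp
    have hcf : ∀ j B, c j (f B) = ∑ n ∈ Finset.range N, sgnf B n * c j (0, E2 n) := by
      intro j B; simp only [hf, map_sum, map_smul, smul_eq_mul]
    have hA : ∀ A : Finset J, ∑ j ∈ A, ∑ n ∈ Finset.range N, c j (0, E2 n) * (x j).2 n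
        ≤ 2 * (C * (K * √N)) := by
      intro A
      have hp : (0 : ℝ) < 2 ^ N := by positivity
      refine le_of_mul_le_mul_left ?_ hp
      calc 2 ^ N * ∑ j ∈ A, ∑ n ∈ Finset.range N, c j (0, E2 n) * (x j).2 n
          ≤ 2 ^ N * ∑ j ∈ A, √(∑ n ∈ Finset.range N, c j (0, E2 n) ^ 2) := by
            refine mul_le_mul_of_nonneg_left (Finset.sum_le_sum fun j _ => ?_) hp.le
            refine (Real.sum_mul_le_sqrt_mul_sqrt _ _ _).trans ?_
            refine mul_le_of_le_one_right (Real.sqrt_nonneg _) ?_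
            refine Real.sqrt_le_one.2 ((l2_le _ _).trans ?_)
            exact pow_le_one₀ (norm_nonneg _) ((norm_snd_le _).trans (hnorm j).le)
        _ ≤ ∑ j ∈ A, 2 * ∑ B ∈ (Finset.range N).powerset, |c j (f B)| := by
            rw [Finset.mul_sum]
            refine Finset.sum_le_sum fun j _ => ?_
            have := khin (fun n => c j (0, E2 n)) (Finset.range N)
            rw [Finset.card_range] at this
            simpa only [hcf] using this
        _ = 2 * ∑ B ∈ (Finset.range N).powerset, ∑ j ∈ A, |c j (f B)| := by
            rw [← Finset.mul_sum, Finset.sum_comm]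
        _ ≤ 2 * ∑ B ∈ (Finset.range N).powerset, C * (K * √N) := by
            refine mul_le_mul_of_nonneg_left (Finset.sum_le_sum fun B _ => ?_) zero_le_two
            refine (hup A _).trans (mul_le_mul_of_nonneg_left ?_ hC0)
            rw [← hfn B]
            exact h.projf A (f B)
        _ = _ := by
            rw [Finset.sum_const, Finset.card_powerset, Finset.card_range, nsmul_eq_mul]
            push_cast; ring
    have hc1 : ∀ n, HasSum (fun j => c j (0, E2 n) * (x j).2 n) 1 := by
      intro n
      have := (h.hs (0, E2 n)).mapL ((lp.evalCLM ℝ (fun _ : ℕ => ℝ) 2 n).comp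
        (ContinuousLinearMap.snd ℝ L1 L2))
      have e : (E2 n : ℕ → ℝ) n = 1 := by rw [E2_apply]; simp
      simp only [ContinuousLinearMap.comp_apply, map_smul, smul_eq_mul] at this
      change HasSum (fun j => c j (0, E2 n) * (x j).2 n) ((E2 n : ℕ → ℝ) n) at this
      rwa [e] at this
    have ht : HasSum (fun j => ∑ n ∈ Finset.range N, c j (0, E2 n) * (x j).2 n)
        (∑ n ∈ Finset.range N, 1) := hasSum_sum fun n _ => hc1 n
    have := le_of_tendsto ht (Eventually.of_forall hA)
    simpa using this
  obtain ⟨N, hN⟩ := exists_nat_gt ((2 * (C * K)) ^ 2)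
  have h1 := key N
  have h3 : √N * √N = (N : ℝ) := Real.mul_self_sqrt (Nat.cast_nonneg N)
  have h4 : 2 * (C * K) < √N := Real.lt_sqrt_of_sq_lt hN
  have h5 : 0 ≤ 2 * (C * K) := by positivity
  nlinarith

lemma UB.reindex {I : Type*} (h : UB x c K) (e : I ≃ J) :
    UB (fun i => x (e i)) (fun i => c (e i)) K := by
  refine ⟨h.hK, fun f => ?_, fun i => h.hself _, fun i k hik => h.hne _ _ (by simpa using hik), ?_⟩
  · exact (e.hasSum_iff (f := fun j => c j f • x j)).2 (h.hs f)
  · intro f A m hm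
    have := h.hm f (A.map e.toEmbedding) (fun j => m (e.symm j)) (by
      intro j hj
      obtain ⟨i, hi, rfl⟩ := Finset.mem_map.1 hj
      simpa using hm i hi)
    simpa using this

lemma can_inl (n : ℕ) : canBasisL1L2 (Sum.inl n) = (E1 n, 0) := rfl
lemma can_inr (n : ℕ) : canBasisL1L2 (Sum.inr n) = (0, E2 n) := rfl

def canCoord : ℕ ⊕ ℕ → L1 × L2 →L[ℝ] ℝ := Sum.elim
  (fun n => (lp.evalCLM ℝ (fun _ : ℕ => ℝ) 1 n).comp (ContinuousLinearMap.fst ℝ L1 L2))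
  (fun n => (lp.evalCLM ℝ (fun _ : ℕ => ℝ) 2 n).comp (ContinuousLinearMap.snd ℝ L1 L2))

lemma canCoord_inl (n : ℕ) (f : L1 × L2) : canCoord (Sum.inl n) f = f.1 n := rfl
lemma canCoord_inr (n : ℕ) (f : L1 × L2) : canCoord (Sum.inr n) f = f.2 n := rfl

lemma can_hasSum (f : L1 × L2) : HasSum (fun j => canCoord j f • canBasisL1L2 j) f := by
  have h1 := (l1_single f.1).mapL (ContinuousLinearMap.inl ℝ L1 L2)
  have h2 := (l2_single f.2).mapL (ContinuousLinearMap.inr ℝ L1 L2)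
  have := HasSum.sum (f := fun j => canCoord j f • canBasisL1L2 j)
    (a := (f.1, (0 : L2))) (b := ((0 : L1), f.2))
    (by
      convert h1 using 1
      · ext1 n
        rw [map_smul, ContinuousLinearMap.inl_apply]
        rfl
      · rw [ContinuousLinearMap.inl_apply])
    (by
      convert h2 using 1
      · ext1 n
        rw [map_smul, ContinuousLinearMap.inr_apply]
        rfl
      · rw [ContinuousLinearMap.inr_apply])
  simpa using this

lemma can_self (j : ℕ ⊕ ℕ) : canCoord j (canBasisL1L2 j) = 1 := by
  rcases j with n | n
  · rw [can_inl, canCoord_inl]; simp [E1_apply]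
  · rw [can_inr, canCoord_inr]; simp [E2_apply]

lemma can_ne (j k : ℕ ⊕ ℕ) (hjk : j ≠ k) : canCoord j (canBasisL1L2 k) = 0 := by
  rcases j with n | n <;> rcases k with m | m
  · rw [can_inl, canCoord_inl]
    have : n ≠ m := fun h => hjk (by rw [h])
    simp [E1_apply, this]
  · rw [can_inr, canCoord_inl]; rfl
  · rw [can_inl, canCoord_inr]; rfl
  · rw [can_inr, canCoord_inr]
    have : n ≠ m := fun h => hjk (by rw [h])
    simp [E2_apply, this]

lemma can_norm (A : Finset (ℕ ⊕ ℕ)) (a : ℕ ⊕ ℕ → ℝ) :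
    ‖∑ j ∈ A, a j • canBasisL1L2 j‖ = max (∑ n ∈ A.toLeft, |a (Sum.inl n)|)
      (√(∑ n ∈ A.toRight, a (Sum.inr n) ^ 2)) := by
  rw [Finset.sum_sum_eq_sum_toLeft_add_sum_toRight, Prod.norm_def]
  congr 1
  · rw [← norm_sum_E1]
    congr 1
    simp [can_inl, can_inr, Prod.fst_sum]
  · rw [← norm_sum_E2, Real.sqrt_sq (norm_nonneg _)]
    congr 1
    simp [can_inl, can_inr, Prod.snd_sum]

lemma closedSpan_top {X I : Type*} [NormedAddCommGroup X] [NormedSpace ℝ X] (y : I → X)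
    (hs : ∀ f : X, ∃ b : I → ℝ, HasSum (fun j => b j • y j) f) (f : X) : f ∈ closedSpan y := by
  obtain ⟨b, hb⟩ := hs f
  have hcl : IsClosed (closedSpan y : Set X) := Submodule.isClosed_topologicalClosure _
  refine hcl.mem_of_tendsto hb (Eventually.of_forall fun A => ?_)
  exact Submodule.sum_mem _ fun j _ => Submodule.smul_mem _ _ (mem_closedSpan y j)

lemma ext_of_hasSum {X Y I : Type*} [NormedAddCommGroup X] [NormedSpace ℝ X]
    [NormedAddCommGroup Y] [NormedSpace ℝ Y] (y : I → X)
    (hs : ∀ f : X, ∃ b : I → ℝ, HasSum (fun j => b j • y j) f) (S T : X →L[ℝ] Y)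
    (hST : ∀ j, S (y j) = T (y j)) (f : X) : S f = T f := by
  obtain ⟨b, hb⟩ := hs f
  have h1 := hb.mapL S
  have h2 := hb.mapL T
  simp only [map_smul, hST] at h1 h2
  exact h1.unique h2

end final

/-- Every normalized unconditional basis of `ℓ₁ ⊕ ℓ₂` (product with the max
norm) is permutatively equivalent to the canonical basis of `ℓ₁ ⊕ ℓ₂`. -/
theorem uniqueness_of_unconditional_basis_l1_l2
    {J : Type} (x : J → (lp (fun _ : ℕ => ℝ) 1) × (lp (fun _ : ℕ => ℝ) 2))
    (hnorm : ∀ j, ‖x j‖ = 1)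
    (hbasis : ∀ f : (lp (fun _ : ℕ => ℝ) 1) × (lp (fun _ : ℕ => ℝ) 2),
      ∃! a : J → ℝ, HasSum (fun j => a j • x j) f) :
    PermutativelyEquivalent x canBasisL1L2 := by
  classical
  obtain ⟨c, K, h⟩ := exists_UB x hnorm hbasis
  have hK := h.hK
  have hcount : Countable J := h.countable hnorm
  set P : J → Prop := fun j => 1 / 2 ≤ |c j ((x j).1, 0)| with hP
  have i1 : Infinite {j // P j} := (h.inf1 hnorm).to_subtype
  have i2 : Infinite {j // ¬ P j} := (h.inf2 hnorm).to_subtype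
  obtain ⟨d1⟩ := nonempty_denumerable {j // P j}
  obtain ⟨d2⟩ := nonempty_denumerable {j // ¬ P j}
  let π : J ≃ ℕ ⊕ ℕ := (Equiv.sumCompl P).symm.trans
    (Equiv.sumCongr (Denumerable.eqv {j // P j}) (Denumerable.eqv {j // ¬ P j}))
  have hπl : ∀ n, P (π.symm (Sum.inl n)) := by
    intro n
    exact ((Denumerable.eqv {j // P j}).symm n).2
  have hπr : ∀ n, ¬ P (π.symm (Sum.inr n)) := by
    intro n
    exact ((Denumerable.eqv {j // ¬ P j}).symm n).2
  have h' := h.reindex π.symm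
  set y : ℕ ⊕ ℕ → L1 × L2 := fun i => x (π.symm i) with hy
  have hny : ∀ i, ‖y i‖ = 1 := fun i => hnorm _
  -- two estimates
  have est1 : ∀ (A : Finset (ℕ ⊕ ℕ)) (a : ℕ ⊕ ℕ → ℝ), ‖∑ j ∈ A, a j • canBasisL1L2 j‖ ≤
      (12 * K ^ 3 * K + 3 * K) * ‖∑ j ∈ A, a j • y j‖ := by
    intro A a
    rw [can_norm]
    set R := ‖∑ j ∈ A, a j • y j‖ with hR
    have hR0 : 0 ≤ R := norm_nonneg _
    refine max_le ?_ ?_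
    · have h1 := h'.part1 hny (A.toLeft.map Function.Embedding.inl) a (by
        intro j hj
        obtain ⟨n, _, rfl⟩ := Finset.mem_map.1 hj
        exact hπl n)
      rw [Finset.sum_map] at h1
      have h2 := h'.proj (A := A) (B := A.toLeft.map Function.Embedding.inl) (by
        intro j hj
        obtain ⟨n, hn, rfl⟩ := Finset.mem_map.1 hj
        exact Finset.mem_toLeft.1 hn) a
      calc _ ≤ _ := h1
        _ ≤ 12 * K ^ 3 * (K * R) := mul_le_mul_of_nonneg_left h2 (by positivity)
        _ ≤ _ := by
          have : 0 ≤ 3 * K * R := by positivity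
          linarith
    · refine Real.sqrt_le_iff.2 ⟨by positivity, ?_⟩
      have h1 := h'.cot hny A a
      rw [Finset.sum_sum_eq_sum_toLeft_add_sum_toRight] at h1
      have h2 : 0 ≤ ∑ n ∈ A.toLeft, a (Sum.inl n) ^ 2 := Finset.sum_nonneg fun _ _ => sq_nonneg _
      have h3 : (3 * (K * R)) ^ 2 ≤ ((12 * K ^ 3 * K + 3 * K) * R) ^ 2 := by
        refine pow_le_pow_left₀ (by positivity) ?_ 2
        have : 0 ≤ 12 * K ^ 3 * K * R := by positivity
        linarith
      have h4 : 0 ≤ (K * R) ^ 2 := sq_nonneg _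
      linarith
  have est2 : ∀ (A : Finset (ℕ ⊕ ℕ)) (a : ℕ ⊕ ℕ → ℝ), ‖∑ j ∈ A, a j • y j‖ ≤
      (1 + 2 * K ^ 2) * ‖∑ j ∈ A, a j • canBasisL1L2 j‖ := by
    intro A a
    rw [can_norm, Finset.sum_sum_eq_sum_toLeft_add_sum_toRight, add_mul, one_mul]
    refine (norm_add_le _ _).trans (add_le_add ?_ ?_)
    · refine le_trans ((norm_sum_le _ _).trans (le_of_eq ?_)) (le_max_left _ _)
      refine Finset.sum_congr rfl fun n _ => ?_
      rw [norm_smul, hny, mul_one, Real.norm_eq_abs]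
    · have h1 := h'.part2 hny (A.toRight.map Function.Embedding.inr) a (by
        intro j hj
        obtain ⟨n, _, rfl⟩ := Finset.mem_map.1 hj
        exact h.split' _ (hπr n))
      rw [Finset.sum_map, Finset.sum_map] at h1
      exact h1.trans (mul_le_mul_of_nonneg_left (le_max_right _ _) (by positivity))
  obtain ⟨S, hS⟩ := UB.exists_map _ h'.hs h'.hself h'.hne canBasisL1L2 _ (by positivity) est1
  obtain ⟨S', hS'⟩ := UB.exists_map _ can_hasSum can_self can_ne y _ (by positivity) est2
  have by1 : ∀ f, ∃ b : ℕ ⊕ ℕ → ℝ, HasSum (fun j => b j • y j) f := fun f => ⟨_, h'.hs f⟩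
  have by2 : ∀ f, ∃ b : ℕ ⊕ ℕ → ℝ, HasSum (fun j => b j • canBasisL1L2 j) f :=
    fun f => ⟨_, can_hasSum f⟩
  have inv1 : ∀ f, S' (S f) = f := ext_of_hasSum y by1 (S'.comp S)
    (ContinuousLinearMap.id ℝ _) (fun j => by simp [hS, hS'])
  have inv2 : ∀ f, S (S' f) = f := ext_of_hasSum canBasisL1L2 by2 (S.comp S')
    (ContinuousLinearMap.id ℝ _) (fun j => by simp [hS, hS'])
  have m1 : ∀ f, f ∈ closedSpan x := closedSpan_top x fun f => ⟨_, h.hs f⟩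
  have m2 : ∀ f, f ∈ closedSpan canBasisL1L2 := closedSpan_top _ by2
  refine ⟨π, ContinuousLinearEquiv.equivOfInverse
    ((S.comp (closedSpan x).subtypeL).codRestrict (closedSpan canBasisL1L2) fun f => m2 _)
    ((S'.comp (closedSpan canBasisL1L2).subtypeL).codRestrict (closedSpan x) fun f => m1 _)
    (fun f => Subtype.ext (inv1 f)) (fun f => Subtype.ext (inv2 f)), fun j => ?_⟩
  have := hS (π j)
  simp only [hy, Equiv.symm_apply_apply] at this
  exact this

end
end

section
/- Every infinite semi-normalized unconditional basic sequence (u_i)_{i∈I} in ℓ₁ whose closed linear span is complemented in ℓ₁ (i.e., is the range of a bounded linear projection on ℓ₁) is permutatively equivalent to the unit vector basis of ℓ₁. (This is the instance A = {1} of the paper's theorem on complemented unconditional basic sequences in ⨁_{p∈A} ℓ_p.) -/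
open scoped ENNReal

noncomputable section

def sg {I : Type} [DecidableEq I] (t : Finset I) (i : I) : ℝ := if i ∈ t then 1 else -1

section
variable {I : Type} [DecidableEq I]

lemma sg_sum_not_mem (s t : Finset I) (j : I) (hj : j ∉ s) (a : I → ℝ) (ht : t ⊆ s) :
    ∑ i ∈ insert j s, sg t i * a i = ∑ i ∈ s, sg t i * a i - a j := by
  have : j ∉ t := fun h => hj (ht h)
  rw [Finset.sum_insert hj]
  simp [sg, this]; ring

lemma sg_sum_mem (s t : Finset I) (j : I) (hj : j ∉ s) (a : I → ℝ) :
    ∑ i ∈ insert j s, sg (insert j t) i * a i = ∑ i ∈ s, sg t i * a i + a j := by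
  rw [Finset.sum_insert hj]
  have : ∑ i ∈ s, sg (insert j t) i * a i = ∑ i ∈ s, sg t i * a i := by
    refine Finset.sum_congr rfl fun i hi => ?_
    have : i ≠ j := fun h => hj (h ▸ hi)
    simp [sg, this]
  rw [this]; simp [sg]; ring

lemma sg_rec (s : Finset I) (j : I) (hj : j ∉ s) (a : I → ℝ) (F : ℝ → ℝ) :
    ∑ t ∈ (insert j s).powerset, F (∑ i ∈ insert j s, sg t i * a i)
    = ∑ t ∈ s.powerset, (F (∑ i ∈ s, sg t i * a i - a j) + F (∑ i ∈ s, sg t i * a i + a j)) := by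
  rw [Finset.sum_powerset_insert hj, ← Finset.sum_add_distrib]
  refine Finset.sum_congr rfl fun t ht => ?_
  rw [sg_sum_mem s t j hj, sg_sum_not_mem s t j hj a (Finset.mem_powerset.1 ht)]

lemma moments (s : Finset I) (a : I → ℝ) :
    ∑ t ∈ s.powerset, (∑ i ∈ s, sg t i * a i) ^ 2 = 2 ^ s.card * ∑ i ∈ s, a i ^ 2 ∧
    ∑ t ∈ s.powerset, (∑ i ∈ s, sg t i * a i) ^ 4 ≤ 3 * 2 ^ s.card * (∑ i ∈ s, a i ^ 2) ^ 2 := by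
  induction s using Finset.induction_on with
  | empty => simp
  | insert j s hj ih =>
    obtain ⟨h2, h4⟩ := ih
    have e2 := sg_rec s j hj a (fun x => x ^ 2)
    have e4 := sg_rec s j hj a (fun x => x ^ 4)
    have p2 : ∀ x : ℝ, (x - a j) ^ 2 + (x + a j) ^ 2 = 2 * x ^ 2 + 2 * a j ^ 2 := fun x => by ring
    have p4 : ∀ x : ℝ, (x - a j) ^ 4 + (x + a j) ^ 4
      = 2 * x ^ 4 + 12 * a j ^ 2 * x ^ 2 + 2 * a j ^ 4 := fun x => by ring
    simp only [p2, p4, Finset.sum_add_distrib, ← Finset.mul_sum, h2, Finset.sum_const,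
      Finset.card_powerset, nsmul_eq_mul] at e2 e4
    rw [e2, e4, Finset.sum_insert hj, Finset.card_insert_of_notMem hj]
    push_cast
    refine ⟨by ring, ?_⟩
    have : (0:ℝ) ≤ 2 ^ s.card * a j ^ 4 := by positivity
    rw [pow_succ (2:ℝ)]
    nlinarith

lemma khin_s14 (s : Finset I) (a : I → ℝ) :
    √(∑ i ∈ s, a i ^ 2) * 2 ^ s.card ≤
     (9/5) * ∑ t ∈ s.powerset, |∑ i ∈ s, sg t i * a i| := by
  obtain ⟨h2, h4⟩ := moments s a
  have hnn : 0 ≤ ∑ i ∈ s, a i ^ 2 := by positivity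
  set σ := √(∑ i ∈ s, a i ^ 2) with hσ
  have hs : ∑ i ∈ s, a i ^ 2 = σ ^ 2 := (Real.sq_sqrt hnn).symm
  rw [hs] at h2 h4
  have hσ0 : 0 ≤ σ := Real.sqrt_nonneg _
  rcases hσ0.eq_or_lt with h | h
  · rw [← h, zero_mul]; positivity
  have key : ∀ x : ℝ, σ ^ 2 * x ^ 2 - 4/27 * x ^ 4 ≤ σ ^ 3 * |x| := by
    intro x
    have h1 : x ^ 2 = |x| ^ 2 := (sq_abs x).symm
    have h3 : x ^ 4 = |x| ^ 4 := by rw [show (4:ℕ) = 2 * 2 from rfl, pow_mul, pow_mul, h1]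
    rw [h1, h3]
    have : 0 ≤ |x| * ((2 * |x| - 3 * σ) ^ 2 * (|x| + 3 * σ)) := by positivity
    nlinarith
  have := Finset.sum_le_sum fun t (_ : t ∈ s.powerset) => key (∑ i ∈ s, sg t i * a i)
  rw [Finset.sum_sub_distrib, ← Finset.mul_sum, ← Finset.mul_sum, ← Finset.mul_sum, h2] at this
  have h5 : σ ^ 3 * (5/9 * (σ * 2 ^ s.card)) ≤
      σ ^ 3 * ∑ t ∈ s.powerset, |∑ i ∈ s, sg t i * a i| := by nlinarith
  have := le_of_mul_le_mul_left h5 (by positivity)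
  linarith
end

abbrev EE := lp (fun _ : ℕ => ℝ) 1

lemma EE.hasSum (x : EE) : HasSum (fun n => |x n|) ‖x‖ := by
  have := lp.hasSum_norm (p := 1) (by simp) x
  simpa using this

lemma keyA {I : Type} [DecidableEq I] (s : Finset I) (x : I → EE) (M D : ℝ)
    (hM : ∀ t ⊆ s, ‖∑ i ∈ s, sg t i • x i‖ ≤ M) (w : ℕ → I → ℝ) (hD0 : 0 ≤ D)
    (hD : ∀ n, √(∑ i ∈ s, w n i ^ 2) ≤ D) (r : ℝ)
    (hr : HasSum (fun n => ∑ i ∈ s, w n i * x i n) r) : r ≤ D * (9/5 * M) := by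
  have hs : HasSum (fun n => D * (9/5 * (2 ^ s.card)⁻¹ * ∑ t ∈ s.powerset, |∑ i ∈ s, sg t i * x i n|))
      (D * (9/5 * (2 ^ s.card)⁻¹ * ∑ t ∈ s.powerset, ‖∑ i ∈ s, sg t i • x i‖)) := by
    refine ((hasSum_sum fun t _ => ?_).mul_left _).mul_left _
    have := EE.hasSum (∑ i ∈ s, sg t i • x i)
    have e : (fun n => |∑ i ∈ s, sg t i * x i n|) = fun n => |(∑ i ∈ s, sg t i • x i : EE) n| := by
      funext n
      rw [lp.coeFn_sum, Finset.sum_apply]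
      simp
    rw [e]; exact this
  refine (hasSum_le (fun n => ?_) hr hs).trans ?_
  · refine (Real.sum_mul_le_sqrt_mul_sqrt s _ _).trans ?_
    have := khin_s14 s (fun i => x i n)
    refine mul_le_mul (hD n) ?_ (Real.sqrt_nonneg _) hD0
    rw [← le_div_iff₀ (by positivity)] at this
    refine this.trans_eq ?_
    field_simp
  · have : ∑ t ∈ s.powerset, ‖∑ i ∈ s, sg t i • x i‖ ≤ 2 ^ s.card * M := by
      refine (Finset.sum_le_card_nsmul _ _ M fun t ht => hM t (Finset.mem_powerset.1 ht)).trans_eq ?_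
      simp
    refine mul_le_mul_of_nonneg_left ?_ hD0
    rw [mul_assoc]
    refine mul_le_mul_of_nonneg_left ?_ (by norm_num)
    rw [inv_mul_le_iff₀ (by positivity)]
    exact this

lemma HasSum.congr_fun_aux {f g : ℕ → ℝ} {r : ℝ} (h : HasSum g r) (hfg : ∀ n, f n = g n) :
    HasSum f r := by
  rw [funext hfg]; exact h

lemma bdd_partial {I X : Type*} [NormedAddCommGroup X] {g : I → X} (hg : Summable g) :
    BddAbove (Set.range fun F : Finset I => ‖∑ i ∈ F, g i‖) := by
  classical
  obtain ⟨s, hs⟩ := cauchySeq_finset_iff_vanishing_norm.1 hg.hasSum.cauchySeq 1 one_pos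
  refine ⟨∑ i ∈ s, ‖g i‖ + 1, ?_⟩
  rintro _ ⟨F, rfl⟩
  have h : ∑ i ∈ F, g i = ∑ i ∈ F ∩ s, g i + ∑ i ∈ F \ s, g i :=
    (Finset.sum_inter_add_sum_sdiff F s g).symm
  simp only
  rw [h]
  refine (norm_add_le _ _).trans (add_le_add ?_ (hs _ Finset.sdiff_disjoint).le)
  refine (norm_sum_le _ _).trans ?_
  exact Finset.sum_le_sum_of_subset_of_nonneg Finset.inter_subset_right fun _ _ _ => norm_nonneg _

lemma coordBound {I : Type} {X : Type} [NormedAddCommGroup X] [NormedSpace ℝ X] [CompleteSpace X]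
    (u : I → X) (c : ℝ) (hc : 0 < c) (hlow : ∀ i, c ≤ ‖u i‖)
    (hbasic : ∀ f ∈ closedSpan u, ∃! a : I → ℝ, HasSum (fun i => a i • u i) f) :
    ∃ A : closedSpan u →ₗ[ℝ] (I → ℝ), (∀ f, HasSum (fun i => A f i • u i) (f : X)) ∧
      (∀ i, A ⟨u i, mem_closedSpan u i⟩ = fun j => open Classical in if j = i then 1 else 0) ∧
      ∃ K : ℝ, 0 ≤ K ∧ ∀ f F, ‖∑ i ∈ F, A f i • u i‖ ≤ K * ‖f‖ := by
  classical
  have hu0 : ∀ i, u i ≠ 0 := fun i => norm_pos_iff.1 (hc.trans_le (hlow i))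
  choose a ha hau using fun f : closedSpan u => hbasic f f.2
  simp only at ha hau
  let A : closedSpan u →ₗ[ℝ] (I → ℝ) :=
    { toFun := a
      map_add' := fun f g => (hau (f + g) _ (by
        have := (ha f).add (ha g)
        simpa [add_smul] using this)).symm
      map_smul' := fun r f => (hau (r • f) _ (by
        have := (ha f).const_smul r
        simpa [mul_smul] using this)).symm }
  have hAa : ∀ f, A f = a f := fun f => rfl
  refine ⟨A, ha, fun i => ?_, ?_⟩
  · refine (hau _ _ ?_).symm
    have := hasSum_ite_eq i (u i)
    convert this using 2 with j
    split_ifs with h <;> simp [h]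
  have : CompleteSpace (closedSpan u) :=
    (Submodule.isClosed_topologicalClosure _).completeSpace_coe
  let Φ : closedSpan u →ₗ[ℝ] lp (fun _ : Finset I => X) ∞ :=
    { toFun := fun f => ⟨fun F => ∑ i ∈ F, A f i • u i, memℓp_infty (bdd_partial (ha f).summable)⟩
      map_add' := fun f g => by
        ext F
        simp only [map_add, Pi.add_apply, add_smul, Finset.sum_add_distrib]
        rfl
      map_smul' := fun r f => by
        ext F
        simp [mul_smul, Finset.smul_sum] }
  have hΦ : ∀ f F, Φ f F = ∑ i ∈ F, A f i • u i := fun f F => rfl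
  have hcont : Continuous Φ := by
    refine Φ.continuous_of_seq_closed_graph fun f x y hf hy => ?_
    have hpt : ∀ F, Filter.Tendsto (fun n => Φ (f n) F) Filter.atTop (nhds (y F)) := by
      intro F
      rw [tendsto_iff_norm_sub_tendsto_zero] at hy ⊢
      refine squeeze_zero (fun _ => norm_nonneg _) (fun n => ?_) hy
      exact lp.norm_apply_le_norm (by simp) (Φ (f n) - y) F
    -- the limit coefficients
    have hb : ∀ i, ∃ b : ℝ, Filter.Tendsto (fun n => A (f n) i) Filter.atTop (nhds b) := by
      intro i
      have h1 : CauchySeq (fun n => A (f n) i • u i) := by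
        have := (hpt {i}).cauchySeq
        simpa [hΦ] using this
      apply cauchySeq_tendsto_of_complete
      rw [Metric.cauchySeq_iff'] at h1 ⊢
      intro ε hε
      obtain ⟨N, hN⟩ := h1 (ε * ‖u i‖) (mul_pos hε (norm_pos_iff.2 (hu0 i)))
      refine ⟨N, fun n hn => ?_⟩
      have := hN n hn
      rw [dist_eq_norm, ← sub_smul, norm_smul] at this
      rw [dist_eq_norm]
      exact lt_of_mul_lt_mul_right this (norm_nonneg _)
    choose b hb using hb
    have hyF : ∀ F, y F = ∑ i ∈ F, b i • u i := by
      intro F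
      refine tendsto_nhds_unique (hpt F) ?_
      simp only [hΦ]
      exact tendsto_finsetSum _ fun i _ => (hb i).smul_const _
    have hsum : HasSum (fun i => b i • u i) (x : X) := by
      rw [HasSum, SummationFilter.unconditional_filter, Metric.tendsto_nhds]
      intro ε hε
      have h1 := Metric.tendsto_nhds.1 hf (ε / 3) (by positivity)
      have h2 := Metric.tendsto_nhds.1 hy (ε / 3) (by positivity)
      obtain ⟨n, hn1, hn2⟩ := (h1.and h2).exists
      have h3 := ha (f n)
      rw [HasSum, SummationFilter.unconditional_filter, Metric.tendsto_nhds] at h3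
      filter_upwards [h3 (ε / 3) (by positivity)] with F hF
      have h4 : dist (Φ (f n) F) (y F) < ε / 3 := by
        refine lt_of_le_of_lt ?_ hn2
        rw [dist_eq_norm, dist_eq_norm]
        exact lp.norm_apply_le_norm (by simp) (Φ (f n) - y) F
      have h5 : dist (f n : X) (x : X) < ε / 3 := hn1
      have h6 : dist (Φ (f n) F) (f n : X) < ε / 3 := hF
      rw [← hyF]
      have t1 := dist_triangle (y F) (Φ (f n) F) (x : X)
      have t2 := dist_triangle (Φ (f n) F) (f n : X) (x : X)
      rw [dist_comm (y F) (Φ (f n) F)] at t1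
      linarith
    have := hau x b hsum
    ext F
    rw [hyF, hΦ, hAa, this]
  let Ψ : closedSpan u →L[ℝ] lp (fun _ : Finset I => X) ∞ := ⟨Φ, hcont⟩
  refine ⟨‖Ψ‖, ContinuousLinearMap.opNorm_nonneg Ψ, fun f F => ?_⟩
  exact (lp.norm_apply_le_norm (by simp) (Ψ f) F).trans (Ψ.le_opNorm f)

lemma build {I : Type} (u : I → EE) (C : ℝ) (hupp : ∀ i, ‖u i‖ ≤ C)
    (A : closedSpan u →ₗ[ℝ] (I → ℝ)) (hA : ∀ f, HasSum (fun i => A f i • u i) (f : EE))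
    (hbasic : ∀ f ∈ closedSpan u, ∃! a : I → ℝ, HasSum (fun i => a i • u i) f)
    (hs : ∀ f, Summable fun i => |A f i|) (π : I ≃ ℕ) :
    PermutativelyEquivalent u (fun n : ℕ => lp.single 1 n (1 : ℝ)) := by
  classical
  have hsm : ∀ x : EE, Summable fun n => ‖x n • u (π.symm n)‖ := by
    intro x
    refine Summable.of_nonneg_of_le (fun _ => norm_nonneg _) (fun n => ?_)
      ((EE.hasSum x).summable.mul_right C)
    rw [norm_smul, Real.norm_eq_abs]
    exact mul_le_mul_of_nonneg_left (hupp _) (abs_nonneg _)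
  have hsx : ∀ x : EE, HasSum (fun n => x n • u (π.symm n)) (∑' n, x n • u (π.symm n)) :=
    fun x => (hsm x).of_norm.hasSum
  let S : EE →ₗ[ℝ] EE :=
    { toFun := fun x => ∑' n, x n • u (π.symm n)
      map_add' := fun x y => by
        refine HasSum.tsum_eq ?_
        have := (hsx x).add (hsx y)
        simpa [add_smul] using this
      map_smul' := fun r x => by
        refine HasSum.tsum_eq ?_
        have := (hsx x).const_smul r
        simpa [mul_smul] using this }
  have hS : ∀ x, HasSum (fun n => x n • u (π.symm n)) (S x) := hsx
  let S' : EE →L[ℝ] EE := S.mkContinuous C (fun x => by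
    have h := (EE.hasSum x).mul_right C
    refine (tsum_of_norm_bounded h (fun n => ?_)).trans_eq (mul_comm _ _)
    rw [norm_smul, Real.norm_eq_abs]
    exact mul_le_mul_of_nonneg_left (hupp _) (abs_nonneg _))
  have hclosed : IsClosed (closedSpan u : Set EE) := Submodule.isClosed_topologicalClosure _
  have hmem : ∀ x, S' x ∈ closedSpan u := fun x =>
    hclosed.mem_of_tendsto (hS x) (Filter.Eventually.of_forall fun F =>
      Submodule.sum_mem _ fun n _ => Submodule.smul_mem _ _ (mem_closedSpan u _))
  have hSI : ∀ x, HasSum (fun i => x (π i) • u i) (S x) := by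
    intro x
    have := (π.hasSum_iff (f := fun n => x n • u (π.symm n))).2 (hS x)
    simpa [Function.comp_def] using this
  let R : closedSpan (fun n : ℕ => (lp.single 1 n (1 : ℝ) : EE)) →L[ℝ] closedSpan u :=
    (S'.comp (Submodule.subtypeL _)).codRestrict _ (fun x => hmem x)
  have hR : ∀ x, (R x : EE) = S x := fun x => rfl
  have : CompleteSpace (closedSpan u) := hclosed.completeSpace_coe
  have : CompleteSpace (closedSpan (fun n : ℕ => (lp.single 1 n (1 : ℝ) : EE))) :=
    (Submodule.isClosed_topologicalClosure _).completeSpace_coe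
  have hexp : ∀ x : EE, x ∈ closedSpan (fun n : ℕ => (lp.single 1 n (1 : ℝ) : EE)) := by
    intro x
    have h := lp.hasSum_single (p := 1) (by simp) x
    refine (Submodule.isClosed_topologicalClosure _).mem_of_tendsto h
      (Filter.Eventually.of_forall fun F => Submodule.sum_mem _ fun n _ => ?_)
    have : (lp.single 1 n (x n) : EE) = x n • (lp.single 1 n (1 : ℝ) : EE) := by
      rw [← lp.single_smul]; simp
    rw [this]
    exact Submodule.smul_mem _ _ (mem_closedSpan (fun n : ℕ => (lp.single 1 n (1 : ℝ) : EE)) n)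
  have hinj : Function.Injective R := by
    intro x y hxy
    have h1 := hSI x
    have h2 := hSI y
    rw [← hR] at h1 h2
    rw [← hxy] at h2
    have := (hbasic _ (R x).2).unique h1 h2
    ext n
    simpa using congrFun this (π.symm n)
  have hsurj : Function.Surjective R := by
    intro f
    have hm : Memℓp (fun n => A f (π.symm n)) 1 := by
      refine memℓp_gen ?_
      simpa [Function.comp_def] using π.symm.summable_iff.2 (hs f)
    refine ⟨⟨⟨_, hm⟩, hexp _⟩, Subtype.ext ?_⟩
    rw [hR]
    refine (hSI _).unique ?_
    simpa using hA f
  let T := ContinuousLinearEquiv.ofBijective R (LinearMap.ker_eq_bot.2 hinj)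
    (LinearMap.range_eq_top.2 hsurj)
  refine ⟨π, T.symm, fun i => ?_⟩
  have : T ⟨lp.single 1 (π i) (1 : ℝ), hexp _⟩ = ⟨u i, mem_closedSpan u i⟩ := by
    refine Subtype.ext ?_
    change S _ = u i
    refine (hSI _).unique ?_
    have := hasSum_ite_eq i (u i)
    convert this using 2 with j
    by_cases h : j = i
    · simp [h]
    · simp [h]
  rw [← this, ContinuousLinearEquiv.symm_apply_apply]

/-- Every infinite semi-normalized unconditional basic sequence in `ℓ₁`
spanning a complemented subspace is permutatively equivalent to the unit vector basis
of `ℓ₁`. -/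
theorem complemented_unconditional_basic_sequence_in_l1
    {I : Type} [Infinite I] (u : I → lp (fun _ : ℕ => ℝ) 1)
    (c C : ℝ) (hc : 0 < c) (hlow : ∀ i, c ≤ ‖u i‖) (hupp : ∀ i, ‖u i‖ ≤ C)
    (hbasic : ∀ f ∈ closedSpan u, ∃! a : I → ℝ, HasSum (fun i => a i • u i) f)
    (hcompl : ∃ P : lp (fun _ : ℕ => ℝ) 1 →L[ℝ] lp (fun _ : ℕ => ℝ) 1,
      (∀ f, P f ∈ closedSpan u) ∧ ∀ f ∈ closedSpan u, P f = f) :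
    PermutativelyEquivalent u (fun n : ℕ => lp.single 1 n (1 : ℝ)) := by
  classical
  obtain ⟨A, hA, hAu, K, hK0, hK⟩ := coordBound u c hc hlow hbasic
  obtain ⟨P, hP1, hP2⟩ := hcompl
  -- coordinate functionals composed with the projection
  let Q : EE →ₗ[ℝ] closedSpan u := (P : EE →ₗ[ℝ] EE).codRestrict _ hP1
  have hQ : ∀ x : EE, ‖Q x‖ ≤ ‖P‖ * ‖x‖ := fun x => P.le_opNorm x
  have hQu : ∀ f : closedSpan u, Q (f : EE) = f := fun f => Subtype.ext (hP2 f f.2)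
  have hcoord : ∀ f i, |A f i| ≤ K / c * ‖f‖ := by
    intro f i
    have h1 := hK f {i}
    rw [Finset.sum_singleton, norm_smul, Real.norm_eq_abs] at h1
    have h2 : |A f i| * c ≤ |A f i| * ‖u i‖ := mul_le_mul_of_nonneg_left (hlow i) (abs_nonneg _)
    rw [div_mul_eq_mul_div, le_div_iff₀ hc]
    linarith
  let φ : I → EE →L[ℝ] ℝ := fun i => LinearMap.mkContinuous
    ((LinearMap.proj i).comp (A.comp Q)) (K / c * ‖P‖) (fun x => by
      have := hcoord (Q x) i
      have h2 := mul_le_mul_of_nonneg_left (hQ x) (div_nonneg hK0 hc.le)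
      simp only [LinearMap.comp_apply, LinearMap.proj_apply, Real.norm_eq_abs]
      linarith)
  have hφ : ∀ i x, φ i x = A (Q x) i := fun i x => rfl
  let e : ℕ → EE := fun n => lp.single 1 n (1 : ℝ)
  have he : ∀ n, ‖e n‖ = 1 := fun n => by simp [e, lp.norm_single]
  have hexp : ∀ x : EE, HasSum (fun n => x n • e n) x := by
    intro x
    have h := lp.hasSum_single (p := 1) (by simp) x
    convert h using 2 with n
    simp [e, ← lp.single_smul]
  have hφexp : ∀ i x, HasSum (fun n => φ i (e n) * x n) (φ i x) := by
    intro i x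
    have := (hexp x).mapL (φ i)
    simpa [mul_comm] using this
  have hsign : ∀ (f : closedSpan u) (s t : Finset I), t ⊆ s →
      ‖∑ i ∈ s, sg t i • (A f i • u i)‖ ≤ 2 * K * ‖f‖ := by
    intro f s t ht
    have : ∑ i ∈ s, sg t i • (A f i • u i) =
        ∑ i ∈ t, A f i • u i - ∑ i ∈ s \ t, A f i • u i := by
      rw [← Finset.sum_sdiff ht, sub_eq_add_neg, add_comm, ← Finset.sum_neg_distrib]
      congr 1
      · refine Finset.sum_congr rfl fun i hi => ?_
        simp [sg, hi]
      · refine Finset.sum_congr rfl fun i hi => ?_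
        simp [sg, (Finset.mem_sdiff.1 hi).2]
    rw [this]
    refine (norm_sub_le _ _).trans ?_
    have h1 := hK f t
    have h2 := hK f (s \ t)
    linarith
  -- cotype 2 estimate
  let D : ℝ := 9/5 * (2 * K * ‖P‖) / c
  have hD0 : 0 ≤ D := by positivity
  have hD : ∀ (s : Finset I) n, √(∑ i ∈ s, φ i (e n) ^ 2) ≤ D := by
    intro s n
    set b : I → ℝ := fun i => φ i (e n) with hb
    set σ := √(∑ i ∈ s, b i ^ 2) with hσ
    have hσ0 : 0 ≤ σ := Real.sqrt_nonneg _
    have hσ2 : σ ^ 2 = ∑ i ∈ s, b i ^ 2 := Real.sq_sqrt (by positivity)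
    have hQe : ‖Q (e n)‖ ≤ ‖P‖ := by simpa [he] using hQ (e n)
    have hsum : HasSum (fun m => ∑ i ∈ s, (b i * SignType.sign (u i m)) * (b i • u i : EE) m)
        (∑ i ∈ s, b i ^ 2 * ‖u i‖) := by
      refine hasSum_sum fun i _ => ?_
      have h := (EE.hasSum (u i)).mul_left (b i ^ 2)
      refine HasSum.congr_fun_aux h fun m => ?_
      have h' := sign_mul_self (u i m)
      simp only [lp.coeFn_smul, Pi.smul_apply, smul_eq_mul]
      rw [← h']; ring
    have := keyA s (fun i => b i • u i) (2 * K * ‖P‖) σ (fun t ht => ?_)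
      (fun m i => b i * SignType.sign (u i m)) hσ0 (fun m => ?_) _ hsum
    · have h1 : c * σ ^ 2 ≤ ∑ i ∈ s, b i ^ 2 * ‖u i‖ := by
        rw [hσ2, Finset.mul_sum]
        refine Finset.sum_le_sum fun i _ => ?_
        rw [mul_comm]
        exact mul_le_mul_of_nonneg_left (hlow i) (sq_nonneg _)
      rcases hσ0.eq_or_lt with h | h
      · rw [← h]; exact hD0
      · have h3 : σ * (σ * c) ≤ σ * (9/5 * (2 * K * ‖P‖)) := by nlinarith
        rw [le_div_iff₀ hc]
        exact le_of_mul_le_mul_left h3 h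
    · refine (hsign (Q (e n)) s t ht).trans ?_
      exact mul_le_mul_of_nonneg_left hQe (by positivity)
    · refine Real.sqrt_le_sqrt (Finset.sum_le_sum fun i _ => ?_)
      rw [mul_pow]
      refine mul_le_of_le_one_right (sq_nonneg _) ?_
      rcases SignType.sign (u i m) with _ | _ | _ <;> simp
  -- the main estimate
  have hmain : ∀ (f : closedSpan u) (s : Finset I),
      ∑ i ∈ s, |A f i| ≤ D * (9/5 * (2 * K * ‖f‖)) := by
    intro f s
    refine keyA s (fun i => A f i • u i) _ D (fun t ht => hsign f s t ht)
      (fun n i => φ i (e n) * SignType.sign (A f i)) hD0 (fun n => ?_) _ ?_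
    · refine le_trans (Real.sqrt_le_sqrt (Finset.sum_le_sum fun i _ => ?_)) (hD s n)
      rw [mul_pow]
      refine mul_le_of_le_one_right (sq_nonneg _) ?_
      rcases SignType.sign (A f i) with _ | _ | _ <;> simp
    · refine hasSum_sum fun i _ => ?_
      have h := (hφexp i (u i)).mul_left |A f i|
      have h1 : φ i (u i) = 1 := by
        rw [hφ, hQu ⟨u i, mem_closedSpan u i⟩, hAu]; simp
      rw [h1, mul_one] at h
      refine HasSum.congr_fun_aux h fun m => ?_
      have h' := sign_mul_self (A f i)
      simp only [lp.coeFn_smul, Pi.smul_apply, smul_eq_mul]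
      rw [← h']; ring
  -- countability
  have hcount : Countable I := by
    have h1 : (⋃ n, {i | A (Q (e n)) i ≠ 0}).Countable := by
      refine Set.countable_iUnion fun n => ?_
      refine (hA (Q (e n))).summable.countable_support.mono fun i hi => ?_
      have : u i ≠ 0 := norm_pos_iff.1 (hc.trans_le (hlow i))
      exact smul_ne_zero hi this
    have h2 : (⋃ n, {i | A (Q (e n)) i ≠ 0}) = Set.univ := by
      refine Set.eq_univ_of_forall fun i => ?_
      by_contra hcon
      simp only [Set.mem_iUnion, Set.mem_ofPred_eq, not_exists, not_not] at hcon
      have h := hφexp i (u i)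
      simp only [hφ, hcon, zero_mul] at h
      have := h.unique hasSum_zero
      rw [hQu ⟨u i, mem_closedSpan u i⟩, hAu] at this
      simp at this
    rw [h2] at h1
    exact Set.countable_univ_iff.1 h1
  obtain ⟨hden⟩ := nonempty_denumerable I
  let π : I ≃ ℕ := Denumerable.eqv I
  exact build u C hupp A hA hbasic (fun f => summable_of_sum_le (fun i => abs_nonneg _) (hmain f)) π

end
end

section
/- Let A be a finite subset of (1,∞). Then ℓ₁ and ⨁_{p∈A} ℓ_p are totally incomparable: no infinite-dimensional Banach space is isomorphic (linearly homeomorphic) both to a closed subspace of ℓ₁ and to a closed subspace of ⨁_{p∈A} ℓ_p. -/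
open scoped ENNReal

noncomputable section

/-- The sequence space `ℓ_p` of real sequences, for a real exponent `p`. -/
abbrev ellp (p : ℝ) : Type := lp (fun _ : ℕ => ℝ) (ENNReal.ofReal p)

instance (p : {q : ℝ // 1 < q}) : Fact ((1 : ℝ≥0∞) ≤ ENNReal.ofReal p.1) :=
  ⟨ENNReal.one_le_ofReal.mpr p.2.le⟩

/-- Two normed spaces are totally incomparable if no infinite-dimensional Banach space embeds
isomorphically as a closed subspace of both; equivalently, any two linearly homeomorphic closed
subspaces (one of each) are finite-dimensional. -/
def TotallyIncomparable (X Y : Type*) [NormedAddCommGroup X] [NormedSpace ℝ X]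
    [NormedAddCommGroup Y] [NormedSpace ℝ Y] : Prop :=
  ∀ (E : Submodule ℝ X) (F : Submodule ℝ Y),
    IsClosed (E : Set X) → IsClosed (F : Set Y) →
      Nonempty (E ≃L[ℝ] F) → FiniteDimensional ℝ E

lemma aux_tail (f : ℕ → ℝ) (hf : Summable f) (ε : ℝ) (hε : 0 < ε) :
    ∀ᶠ m : ℕ in Filter.atTop, ∃ s, s < ε ∧ HasSum (fun i => if i < m then 0 else f i) s := by
  have h := hf.hasSum.tendsto_sum_nat
  filter_upwards [h.eventually (lt_mem_nhds (sub_lt_self (∑' i, f i) hε))] with m hm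
  refine ⟨∑' i, f i - ∑ i ∈ Finset.range m, f i, by linarith, ?_⟩
  have h1 : HasSum (fun i => if i < m then f i else 0) (∑ i ∈ Finset.range m, f i) := by
    have h2 : ∑ i ∈ Finset.range m, f i
        = ∑ i ∈ Finset.range m, (if i < m then f i else 0) := by
      apply Finset.sum_congr rfl
      intro i hi
      simp [Finset.mem_range.mp hi]
    rw [h2]
    apply hasSum_sum_of_ne_finset_zero
    intro i hi
    simp at hi
    simp [hi]
  have h3 := hf.hasSum.sub h1
  have h4 : (fun i => if i < m then 0 else f i) = fun i => f i - (if i < m then f i else 0) := by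
    funext i
    split_ifs <;> simp
  rw [h4]
  exact h3

lemma aux_pow (p a b : ℝ) (hp : 1 < p) : |a + b| ^ p ≤ 2 ^ p * (|a| ^ p + |b| ^ p) := by
  have h0 : 0 ≤ p := by linarith
  have ha : 0 ≤ |a| ^ p := by positivity
  have hb : 0 ≤ |b| ^ p := by positivity
  have h2 : (0:ℝ) < 2 ^ p := by positivity
  have key : |a + b| ≤ 2 * max |a| |b| := by
    have := abs_add_le a b
    have := le_max_left |a| |b|
    have := le_max_right |a| |b|
    linarith
  have hm : 0 ≤ max |a| |b| := le_max_of_le_left (abs_nonneg a)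
  calc |a + b| ^ p ≤ (2 * max |a| |b|) ^ p := Real.rpow_le_rpow (abs_nonneg _) key h0
    _ = 2 ^ p * (max |a| |b|) ^ p := Real.mul_rpow (by norm_num) hm
    _ ≤ _ := by
      gcongr
      rcases max_choice |a| |b| with h | h <;> rw [h] <;> linarith

lemma aux_lp (p : ℝ) (hp : 1 < p) (y : ellp p) : ∀ᶠ m : ℕ in Filter.atTop,
    ∀ v : ellp p, (∀ i < m, v i = 0) →
      ‖y + v‖ ^ p ≤ ‖y‖ ^ p + 2 ^ p * (1 + ‖v‖ ^ p) := by
  have hr : (ENNReal.ofReal p).toReal = p := ENNReal.toReal_ofReal (by linarith)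
  have hpos : 0 < (ENNReal.ofReal p).toReal := by rw [hr]; linarith
  have hs : ∀ z : ellp p, HasSum (fun i => |z i| ^ p) (‖z‖ ^ p) := by
    intro z
    have := lp.hasSum_norm hpos z
    simpa only [hr, Real.norm_eq_abs] using this
  filter_upwards [aux_tail _ (hs y).summable 1 one_pos] with m hm v hv
  obtain ⟨s, hs1, hs2⟩ := hm
  have h2 : (0:ℝ) < 2 ^ p := by positivity
  have h3 : ‖y + v‖ ^ p ≤ ‖y‖ ^ p + 2 ^ p * (s + ‖v‖ ^ p) := by
    refine hasSum_le ?_ (hs (y + v)) ((hs y).add ((hs2.add (hs v)).mul_left (2 ^ p)))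
    intro i
    have e : (y + v) i = y i + v i := rfl
    simp only [e]
    have ha : 0 ≤ |y i| ^ p := by positivity
    split_ifs with hi
    · have : 0 ≤ 2 ^ p * |v i| ^ p := by positivity
      rw [hv i hi] at *
      simp only [add_zero, zero_add]
      linarith
    · have := aux_pow p (y i) (v i) hp
      linarith
  nlinarith

lemma aux_l1 (x : lp (fun _ : ℕ => ℝ) 1) : ∀ᶠ m : ℕ in Filter.atTop,
    ∀ u : lp (fun _ : ℕ => ℝ) 1, (∀ i < m, u i = 0) →
      ‖x‖ + ‖u‖ - 1 / 2 ≤ ‖x + u‖ := by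
  have hs : ∀ z : lp (fun _ : ℕ => ℝ) 1, HasSum (fun i => |z i|) ‖z‖ := by
    intro z
    have := lp.hasSum_norm (p := 1) (by simp) z
    simpa using this
  filter_upwards [aux_tail _ (hs x).summable (1 / 4) (by norm_num)] with m hm u hu
  obtain ⟨s, hs1, hs2⟩ := hm
  have h3 : ‖x‖ + ‖u‖ - 2 * s ≤ ‖x + u‖ := by
    refine hasSum_le ?_ (((hs x).add (hs u)).sub (hs2.mul_left 2)) (hs (x + u))
    intro i
    have e : (x + u) i = x i + u i := rfl
    simp only [e]
    split_ifs with hi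
    · rw [hu i hi]; simp
    · have := abs_sub_abs_le_abs_sub (u i) (-x i)
      rw [abs_neg, sub_neg_eq_add, add_comm (u i)] at this
      linarith
  linarith

lemma aux_growth (p C c : ℝ) (hp : 1 < p) (hc : 0 < c) :
    ∀ᶠ n : ℕ in Filter.atTop, n * C < (c * n) ^ p := by
  have h : Filter.Tendsto (fun n : ℕ => (n : ℝ) ^ (p - 1)) Filter.atTop Filter.atTop :=
    (tendsto_rpow_atTop (by linarith)).comp tendsto_natCast_atTop_atTop
  filter_upwards [h.eventually_gt_atTop (C / c ^ p), Filter.eventually_gt_atTop 0] with n hn h0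
  have hn0 : (0:ℝ) < n := by exact_mod_cast h0
  have hcp : 0 < c ^ p := by positivity
  rw [div_lt_iff₀ hcp] at hn
  rw [Real.mul_rpow hc.le hn0.le]
  have : (n:ℝ) ^ p = n ^ (p - 1) * n := by
    rw [← Real.rpow_add_one hn0.ne']; simp
  rw [this]
  nlinarith


/-- For any finite `A ⊆ (1,∞)`, the spaces `ℓ₁` and `⨁_{p ∈ A} ℓ_p`
are totally incomparable. -/
theorem l1_totally_incomparable_direct_sum_lp
    (A : Finset {q : ℝ // 1 < q}) :
    TotallyIncomparable (lp (fun _ : ℕ => ℝ) 1) (PiLp ⊤ (fun p : A => ellp p.1.1)) := by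
  intro E F _ _ ⟨T⟩
  by_contra hE
  have huniq : ∀ m : ℕ, ∃ u : E, ‖u‖ = 1 ∧ (∀ i < m, (u : lp (fun _ : ℕ => ℝ) 1) i = 0) ∧
      ∀ p : A, ∀ i < m, ((T u : F) : PiLp ⊤ (fun p : A => ellp p.1.1)) p i = 0 := by
    intro m
    let L : E →ₗ[ℝ] ((Fin m → ℝ) × (A → Fin m → ℝ)) :=
      { toFun := fun u => (fun i => (u : lp (fun _ : ℕ => ℝ) 1) i,
          fun p i => ((T u : F) : PiLp ⊤ (fun p : A => ellp p.1.1)) p i)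
        map_add' := by
          intro a b
          rw [map_add]
          rfl
        map_smul' := by
          intro r a
          rw [map_smul]
          rfl }
    have hL : ¬ Function.Injective L := fun h => hE (FiniteDimensional.of_injective L h)
    rw [← LinearMap.ker_eq_bot, Submodule.eq_bot_iff] at hL
    push Not at hL
    obtain ⟨w, hw, hw0⟩ := hL
    have hu : L (‖w‖⁻¹ • w) = 0 := by
      rw [map_smul, LinearMap.mem_ker.mp hw, smul_zero]
    refine ⟨‖w‖⁻¹ • w, ?_, ?_, ?_⟩
    · rw [norm_smul, norm_inv, norm_norm, inv_mul_cancel₀ (norm_ne_zero_iff.mpr hw0)]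
    · intro i hi
      exact congrFun (congrArg Prod.fst hu) ⟨i, hi⟩
    · intro p i hi
      exact congrFun (congrFun (congrArg Prod.snd hu) p) ⟨i, hi⟩
  obtain ⟨K, hK0, hK⟩ := (T : E →L[ℝ] F).bound
  obtain ⟨M, hM0, hM⟩ := (T.symm : F →L[ℝ] E).bound
  have hcomp : ∀ (y : PiLp ⊤ (fun p : A => ellp p.1.1)) (p : A), ‖y p‖ ≤ ‖y‖ := by
    intro y p
    exact PiLp.norm_apply_le y p
  have hind : ∀ n : ℕ, ∃ x : E, (n : ℝ) / 2 ≤ ‖x‖ ∧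
      ∀ p : A, ‖((T x : F) : PiLp ⊤ (fun p : A => ellp p.1.1)) p‖ ^ p.1.1
        ≤ n * (2 ^ p.1.1 * (1 + K ^ p.1.1)) := by
    intro n
    induction n with
    | zero =>
      refine ⟨0, by simp, fun p => ?_⟩
      have hp := p.1.2
      have h0 : ((T 0 : F) : PiLp ⊤ (fun p : A => ellp p.1.1)) p = 0 := by
        rw [map_zero]; rfl
      rw [h0, norm_zero, Real.zero_rpow (by linarith)]
      simp
    | succ n ih =>
      obtain ⟨x, hx, hxp⟩ := ih
      have hall : ∀ᶠ m : ℕ in Filter.atTop, ∀ p : A, ∀ v : ellp p.1.1, (∀ i < m, v i = 0) →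
          ‖((T x : F) : PiLp ⊤ (fun p : A => ellp p.1.1)) p + v‖ ^ p.1.1
          ≤ ‖((T x : F) : PiLp ⊤ (fun p : A => ellp p.1.1)) p‖ ^ p.1.1
            + 2 ^ p.1.1 * (1 + ‖v‖ ^ p.1.1) :=
        Filter.eventually_all.mpr fun p => aux_lp p.1.1 p.1.2 _
      obtain ⟨m, hm1, hm2⟩ := ((aux_l1 (x : lp (fun _ : ℕ => ℝ) 1)).and hall).exists
      obtain ⟨u, hu, hu1, hu2⟩ := huniq m
      refine ⟨x + u, ?_, fun p => ?_⟩
      · have h1 := hm1 u hu1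
        have h2 : ‖(u : lp (fun _ : ℕ => ℝ) 1)‖ = 1 := hu
        have h3 : ‖x + u‖ = ‖(x : lp (fun _ : ℕ => ℝ) 1) + u‖ := rfl
        have h4 : ‖x‖ = ‖(x : lp (fun _ : ℕ => ℝ) 1)‖ := rfl
        rw [h3]
        rw [h4] at hx
        push_cast
        linarith
      · have h1 := hm2 p _ (hu2 p)
        have hp := p.1.2
        have h2 : ((T (x + u) : F) : PiLp ⊤ (fun p : A => ellp p.1.1)) p
            = ((T x : F) : PiLp ⊤ (fun p : A => ellp p.1.1)) p
              + ((T u : F) : PiLp ⊤ (fun p : A => ellp p.1.1)) p := by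
          rw [map_add]; rfl
        have h3 : ‖((T u : F) : PiLp ⊤ (fun p : A => ellp p.1.1)) p‖ ≤ K := by
          refine (hcomp _ p).trans ?_
          have := hK u
          rw [hu, mul_one] at this
          exact this
        have h4 : ‖((T u : F) : PiLp ⊤ (fun p : A => ellp p.1.1)) p‖ ^ p.1.1 ≤ K ^ p.1.1 :=
          Real.rpow_le_rpow (norm_nonneg _) h3 (by linarith)
        have h5 : (0:ℝ) < 2 ^ p.1.1 := by positivity
        have h6 := hxp p
        rw [h2]
        push_cast
        nlinarith
  have hgr : ∀ᶠ n : ℕ in Filter.atTop, ∀ p : A,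
      n * (2 ^ p.1.1 * (1 + K ^ p.1.1)) < (1 / (2 * M) * n) ^ p.1.1 :=
    Filter.eventually_all.mpr fun p => aux_growth _ _ _ p.1.2 (by positivity)
  obtain ⟨n, hn, hn0⟩ := (hgr.and (Filter.eventually_gt_atTop 0)).exists
  obtain ⟨x, hx, hxp⟩ := hind n
  have hnpos : (0:ℝ) < n := by exact_mod_cast hn0
  have hb : 0 < 1 / (2 * M) * (n:ℝ) := by positivity
  have hlt : ‖T x‖ < 1 / (2 * M) * n := by
    change ‖((T x : F) : PiLp ⊤ (fun p : A => ellp p.1.1))‖ < _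
    rw [← PiLp.norm_ofLp, pi_norm_lt_iff hb]
    intro p
    have hp := p.1.2
    exact (Real.rpow_lt_rpow_iff (norm_nonneg _) hb.le (by linarith)).mp ((hxp p).trans_lt (hn p))
  have h1 := hM (T x)
  have h2 : (T.symm : F →L[ℝ] E) (T x) = x := T.symm_apply_apply x
  rw [h2] at h1
  have h3 : ‖x‖ ≤ M * ‖T x‖ := h1
  have h4 : M * ‖T x‖ < M * (1 / (2 * M) * n) := mul_lt_mul_of_pos_left hlt hM0
  have h5 : M * (1 / (2 * M) * n) = n / 2 := by field_simp
  linarith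

end
end
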